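/- arXiv:1201.5241 — 8 statements merged into one kernel-verified Lean document; each statement's English description precedes it below -/
import Mathlib

section
/- The closed convex cone generated by the s-Gaussian functions is contained in the closure of the set of positive scalar multiples of v-Gaussian functions: con(Υ_{s,n}) ⊆ W̄(Υ_{v,n}). -/
open MeasureTheory

noncomputable section

/-- The principal submatrix of `K` with rows and columns indexed by `α`. -/
def principalSub {n : ℕ} (K : Matrix (Fin n) (Fin n) ℝ) (α : Finset (Fin n)) :
    Matrix {i // i ∈ α} {i // i ∈ α} ℝ :=
  K.submatrix (fun i => i.1) (fun i => i.1)

/-- A closed convex cone: a closed convex set stable under positive scaling. -/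
def IsClosedConvexCone {E : Type*} [AddCommMonoid E] [Module ℝ E] [TopologicalSpace E]
    (C : Set E) : Prop :=
  IsClosed C ∧ Convex ℝ C ∧ ∀ c : ℝ, 0 < c → ∀ x ∈ C, c • x ∈ C

/-- `ccc S` is the smallest closed convex cone containing `S`. -/
def ccc {E : Type*} [AddCommMonoid E] [Module ℝ E] [TopologicalSpace E] (S : Set E) : Set E :=
  ⋂₀ {C : Set E | IsClosedConvexCone C ∧ S ⊆ C}

/-- `Wscale S` is the set of positive scalar multiples of elements of `S`. -/
def Wscale {E : Type*} [SMul ℝ E] (S : Set E) : Set E :=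
  {h | ∃ c : ℝ, 0 < c ∧ ∃ g ∈ S, h = c • g}

/-- The rank function `φⁿᵢ`. -/
def phiFn (n : ℕ) (i : Fin n) : Finset (Fin n) → ℝ :=
  fun α => if i ∈ α then -1 else 0

/-- s-Gaussian rank functions: differential entropy functions of `n` jointly Gaussian
scalar random variables with positive definite covariance matrix. -/
def IsSGaussian (n : ℕ) (g : Finset (Fin n) → ℝ) : Prop :=
  ∃ K : Matrix (Fin n) (Fin n) ℝ, K.PosDef ∧
    ∀ α : Finset (Fin n),
      g α = 1 / 2 * Real.logb 2
        ((2 * Real.pi * Real.exp 1) ^ α.card * (principalSub K α).det)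

/-- The principal submatrix on the blocks indexed by `α`. -/
def vPrincipal {n : ℕ} {k : Fin n → ℕ}
    (K : Matrix ((i : Fin n) × Fin (k i)) ((i : Fin n) × Fin (k i)) ℝ)
    (α : Finset (Fin n)) :
    Matrix {p : (i : Fin n) × Fin (k i) // p.1 ∈ α}
      {p : (i : Fin n) × Fin (k i) // p.1 ∈ α} ℝ :=
  K.submatrix (fun p => p.1) (fun p => p.1)

/-- v-Gaussian rank functions: differential entropy functions of `n` jointly Gaussian
random vectors of positive lengths `k i`, with positive definite joint covariance. -/
def IsVGaussian (n : ℕ) (g : Finset (Fin n) → ℝ) : Prop :=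
  ∃ k : Fin n → ℕ, (∀ i, 0 < k i) ∧
    ∃ K : Matrix ((i : Fin n) × Fin (k i)) ((i : Fin n) × Fin (k i)) ℝ, K.PosDef ∧
      ∀ α : Finset (Fin n),
        g α = 1 / 2 * Real.logb 2
          ((2 * Real.pi * Real.exp 1) ^ (∑ i ∈ α, k i) * (vPrincipal K α).det)

/-- Normalised Gaussian entropy functions: all blocks have common length `T`, and the
entropy function is multiplied by `1/T`. -/
def IsNormGaussian (n : ℕ) (g : Finset (Fin n) → ℝ) : Prop :=
  ∃ T : ℕ, 0 < T ∧
    ∃ K : Matrix (Fin n × Fin T) (Fin n × Fin T) ℝ, K.PosDef ∧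
      ∀ α : Finset (Fin n),
        g α = (1 / (T : ℝ)) * (1 / 2 * Real.logb 2
          ((2 * Real.pi * Real.exp 1) ^ (T * α.card) *
            (K.submatrix (fun p : {p : Fin n × Fin T // p.1 ∈ α} => p.1)
              (fun p => p.1)).det))

/-- `g` is the differential entropy function of scalar random variables `X`:
the joint law has a density, every nonempty subtuple has a density whose entropy
integrand is integrable, `g ∅ = 0`, and `g α = h(X_α)` (base-2). -/
def SEntropyData (n : ℕ) (Ω : Type) [MeasureSpace Ω] (X : Fin n → Ω → ℝ)
    (g : Finset (Fin n) → ℝ) : Prop :=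
  IsProbabilityMeasure (volume : Measure Ω) ∧
  Measurable (fun ω i => X i ω) ∧
  (∃ f : (Fin n → ℝ) → ℝ, Measurable f ∧ (∀ x, 0 ≤ f x) ∧
    Measure.map (fun ω i => X i ω) volume
      = volume.withDensity fun x => ENNReal.ofReal (f x)) ∧
  g ∅ = 0 ∧
  ∀ α : Finset (Fin n), α.Nonempty →
    ∃ f : ({i // i ∈ α} → ℝ) → ℝ, Measurable f ∧ (∀ x, 0 ≤ f x) ∧
      Measure.map (fun ω (i : {i // i ∈ α}) => X i.1 ω) volume
        = volume.withDensity (fun x => ENNReal.ofReal (f x)) ∧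
      Integrable (fun x => f x * Real.logb 2 (f x)) ∧
      g α = -∫ x, f x * Real.logb 2 (f x)

/-- s-entropic rank functions. -/
def IsSEntropic (n : ℕ) (g : Finset (Fin n) → ℝ) : Prop :=
  ∃ (Ω : Type) (m : MeasureSpace Ω) (X : Fin n → Ω → ℝ), @SEntropyData n Ω m X g

/-- `g` is the differential entropy function of random vectors `X i : Ω → ℝ^{k i}`. -/
def VEntropyData (n : ℕ) (k : Fin n → ℕ) (Ω : Type) [MeasureSpace Ω]
    (X : (i : Fin n) → Ω → (Fin (k i) → ℝ)) (g : Finset (Fin n) → ℝ) : Prop :=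
  IsProbabilityMeasure (volume : Measure Ω) ∧
  Measurable (fun ω (i : Fin n) => X i ω) ∧
  (∃ f : ((i : Fin n) → Fin (k i) → ℝ) → ℝ, Measurable f ∧ (∀ x, 0 ≤ f x) ∧
    Measure.map (fun ω (i : Fin n) => X i ω) volume
      = volume.withDensity fun x => ENNReal.ofReal (f x)) ∧
  g ∅ = 0 ∧
  ∀ α : Finset (Fin n), α.Nonempty →
    ∃ f : ((i : {i // i ∈ α}) → Fin (k i.1) → ℝ) → ℝ, Measurable f ∧ (∀ x, 0 ≤ f x) ∧
      Measure.map (fun ω (i : {i // i ∈ α}) => X i.1 ω) volume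
        = volume.withDensity (fun x => ENNReal.ofReal (f x)) ∧
      Integrable (fun x => f x * Real.logb 2 (f x)) ∧
      g α = -∫ x, f x * Real.logb 2 (f x)

/-- v-entropic rank functions. -/
def IsVEntropic (n : ℕ) (g : Finset (Fin n) → ℝ) : Prop :=
  ∃ k : Fin n → ℕ, (∀ i, 0 < k i) ∧
    ∃ (Ω : Type) (m : MeasureSpace Ω) (X : (i : Fin n) → Ω → (Fin (k i) → ℝ)),
      @VEntropyData n k Ω m X g

/-- s-representable rank functions. -/
def IsSRepresentable (n : ℕ) (g : Finset (Fin n) → ℝ) : Prop :=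
  ∃ (k : ℕ) (A : Fin n → Fin k → ℝ),
    ∀ α : Finset (Fin n),
      g α = (Module.finrank ℝ ↥(Submodule.span ℝ (A '' (α : Set (Fin n)))) : ℝ)

/-- v-representable rank functions. -/
def IsVRepresentable (n : ℕ) (g : Finset (Fin n) → ℝ) : Prop :=
  ∃ (d : ℕ) (k : Fin n → ℕ) (A : (i : Fin n) → Fin (k i) → (Fin d → ℝ)),
    ∀ α : Finset (Fin n),
      g α = (Module.finrank ℝ
        ↥(Submodule.span ℝ {v : Fin d → ℝ | ∃ i ∈ α, ∃ j, v = A i j}) : ℝ)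

/-- The marginal probability mass function of a joint pmf `p` on the coordinates in `α`. -/
def marginalPMF {n : ℕ} (S : Fin n → ℕ) (p : ((i : Fin n) → Fin (S i)) → ℝ)
    (α : Finset (Fin n)) (x : (i : {i // i ∈ α}) → Fin (S i.1)) : ℝ :=
  ∑ y : (i : Fin n) → Fin (S i), if ∀ i : {i // i ∈ α}, y i.1 = x i then p y else 0

/-- The Shannon entropy (base 2) of the subtuple indexed by `α`. -/
def discEntropyFn {n : ℕ} (S : Fin n → ℕ) (p : ((i : Fin n) → Fin (S i)) → ℝ)
    (α : Finset (Fin n)) : ℝ :=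
  -∑ x : (i : {i // i ∈ α}) → Fin (S i.1),
    marginalPMF S p α x * Real.logb 2 (marginalPMF S p α x)

/-- Entropic rank functions: Shannon entropy functions of finitely-valued
discrete random variables. -/
def IsEntropic (n : ℕ) (g : Finset (Fin n) → ℝ) : Prop :=
  ∃ (S : Fin n → ℕ) (p : ((i : Fin n) → Fin (S i)) → ℝ),
    (∀ x, 0 ≤ p x) ∧ (∑ x, p x = 1) ∧ ∀ α, g α = discEntropyFn S p α

/-- The Ingleton inequality for a rank function on four variables. -/
def IngletonIneq (g : Finset (Fin 4) → ℝ) (i j k l : Fin 4) : Prop :=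
  g {i} + g {j} + g {k, l} + g {i, j, k} + g {i, j, l} ≤
    g {i, j} + g {i, k} + g {i, l} + g {j, k} + g {j, l}

/-- The closure of the positive multiples of an additively closed set is a closed convex cone. -/
theorem isClosedConvexCone_closure_Wscale {E : Type*} [AddCommMonoid E] [Module ℝ E]
    [TopologicalSpace E] [ContinuousAdd E] [ContinuousSMul ℝ E] {S : Set E}
    (hS : ∀ x ∈ S, ∀ y ∈ S, x + y ∈ S) : IsClosedConvexCone (closure (Wscale S)) := by
  have hsmul : ∀ c : ℝ, 0 < c → ∀ x ∈ closure (Wscale S), c • x ∈ closure (Wscale S) := by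
    intro c hc x hx
    refine map_mem_closure (continuous_const_smul c) hx ?_
    rintro _ ⟨d, hd, g, hg, rfl⟩
    exact ⟨c * d, mul_pos hc hd, g, hg, smul_smul c d g⟩
  have hnsmul : ∀ p : ℕ, 0 < p → ∀ x ∈ S, (p : ℝ) • x ∈ S := by
    intro p hp x hx
    induction p, hp using Nat.le_induction with
    | base => simpa using hx
    | succ p _ ih =>
      rw [Nat.cast_succ, add_smul, one_smul]
      exact hS _ ih _ hx
  have hadd : ∀ x ∈ closure (Wscale S), ∀ y ∈ closure (Wscale S),
      x + y ∈ closure (Wscale S) := by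
    intro x hx y hy
    rw [← closure_closure]
    refine map_mem_closure₂ continuous_add hx hy ?_
    rintro _ ⟨a, ha, g, hg, rfl⟩ _ ⟨b, hb, h, hh, rfl⟩
    have lim : Filter.Tendsto
        (fun t : ℝ => ((⌈a * t⌉₊ : ℝ) / t) • g + ((⌈b * t⌉₊ : ℝ) / t) • h)
        Filter.atTop (nhds (a • g + b • h)) :=
      ((tendsto_nat_ceil_mul_div_atTop ha.le).smul_const g).add
        ((tendsto_nat_ceil_mul_div_atTop hb.le).smul_const h)
    refine mem_closure_of_tendsto lim ?_
    filter_upwards [Filter.eventually_gt_atTop 0] with t ht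
    refine ⟨t⁻¹, inv_pos.2 ht, _,
      hS _ (hnsmul ⌈a * t⌉₊ (Nat.ceil_pos.2 (mul_pos ha ht)) g hg)
        _ (hnsmul ⌈b * t⌉₊ (Nat.ceil_pos.2 (mul_pos hb ht)) h hh), ?_⟩
    rw [smul_add, smul_smul, smul_smul, div_eq_inv_mul, div_eq_inv_mul]
  refine ⟨isClosed_closure, convex_iff_forall_pos.2 ?_, hsmul⟩
  intro x hx y hy a b ha hb _
  exact hadd _ (hsmul a ha x hx) _ (hsmul b hb y hy)

/-- A block diagonal matrix with positive definite diagonal blocks is positive definite. -/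
theorem posDef_fromBlocks_zero {l m : Type*} [Fintype l] [Fintype m]
    {A : Matrix l l ℝ} {B : Matrix m m ℝ} (hA : A.PosDef) (hB : B.PosDef) :
    (Matrix.fromBlocks A 0 0 B).PosDef := by
  refine Matrix.PosDef.of_dotProduct_mulVec_pos
    (hA.isHermitian.fromBlocks (by simp) hB.isHermitian) fun x hx => ?_
  have key : star x ⬝ᵥ (Matrix.fromBlocks A 0 0 B).mulVec x =
      star (x ∘ Sum.inl) ⬝ᵥ A.mulVec (x ∘ Sum.inl) +
        star (x ∘ Sum.inr) ⬝ᵥ B.mulVec (x ∘ Sum.inr) := by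
    simp [Matrix.fromBlocks_mulVec, dotProduct, Fintype.sum_sum_type]
  rw [key]
  by_cases h : x ∘ Sum.inl = 0
  · have h' : x ∘ Sum.inr ≠ 0 := by
      intro h'
      refine hx (funext ?_)
      rintro (i | i)
      · exact congrFun h i
      · exact congrFun h' i
    simpa [h] using hB.dotProduct_mulVec_pos h'
  · exact add_pos_of_pos_of_nonneg (hA.dotProduct_mulVec_pos h)
      (hB.posSemidef.dotProduct_mulVec_nonneg _)

/-- Concatenating blocks of lengths `k i` and `l i` splits the index set as a disjoint union. -/
def sigmaFinAddEquiv {n : ℕ} (k l : Fin n → ℕ) :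
    ((i : Fin n) × Fin (k i + l i)) ≃ ((i : Fin n) × Fin (k i)) ⊕ ((i : Fin n) × Fin (l i)) :=
  (Equiv.sigmaCongrRight fun _ => finSumFinEquiv.symm).trans (Equiv.sigmaSumDistrib _ _)

theorem sigmaFinAddEquiv_fst {n : ℕ} (k l : Fin n → ℕ) (p : (i : Fin n) × Fin (k i + l i)) :
    Sum.elim Sigma.fst Sigma.fst (sigmaFinAddEquiv k l p) = p.1 := by
  obtain ⟨i, j⟩ := p
  rcases h : finSumFinEquiv.symm j with a | a <;>
    simp [sigmaFinAddEquiv, h]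

theorem vPrincipal_posDef {n : ℕ} {k : Fin n → ℕ}
    {K : Matrix ((i : Fin n) × Fin (k i)) ((i : Fin n) × Fin (k i)) ℝ} (hK : K.PosDef)
    (α : Finset (Fin n)) : (vPrincipal K α).PosDef :=
  hK.submatrix Subtype.val_injective

theorem det_vPrincipal_fromBlocks {n : ℕ} {k l : Fin n → ℕ}
    (K : Matrix ((i : Fin n) × Fin (k i)) ((i : Fin n) × Fin (k i)) ℝ)
    (L : Matrix ((i : Fin n) × Fin (l i)) ((i : Fin n) × Fin (l i)) ℝ) (α : Finset (Fin n)) :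
    (vPrincipal (k := fun i => k i + l i) ((Matrix.fromBlocks K 0 0 L).submatrix
      (sigmaFinAddEquiv k l) (sigmaFinAddEquiv k l)) α).det =
      (vPrincipal K α).det * (vPrincipal L α).det := by
  rw [← Matrix.det_fromBlocks_zero₂₁ (vPrincipal K α) 0 (vPrincipal L α)]
  let e : {p : (i : Fin n) × Fin (k i + l i) // p.1 ∈ α} ≃
      {p : (i : Fin n) × Fin (k i) // p.1 ∈ α} ⊕ {p : (i : Fin n) × Fin (l i) // p.1 ∈ α} :=
    ((sigmaFinAddEquiv k l).subtypeEquiv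
    (q := fun s => Sum.elim Sigma.fst Sigma.fst s ∈ α)
    (fun p => by rw [sigmaFinAddEquiv_fst])).trans Equiv.subtypeSum
  rw [← Matrix.det_submatrix_equiv_self e.symm]
  congr 1
  have he : ∀ s, sigmaFinAddEquiv k l (e.symm s).1 = s.map Subtype.val Subtype.val := by
    rintro (s | s) <;> exact (sigmaFinAddEquiv k l).apply_symm_apply _
  ext (p | p) (q | q) <;> simp [vPrincipal, he]

theorem IsVGaussian.add {n : ℕ} {g h : Finset (Fin n) → ℝ} (hg : IsVGaussian n g)
    (hh : IsVGaussian n h) : IsVGaussian n (g + h) := by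
  obtain ⟨k, hk, K, hK, hg⟩ := hg
  obtain ⟨l, hl, L, hL, hh⟩ := hh
  refine ⟨fun i => k i + l i, fun i => Nat.add_pos_left (hk i) _,
    (Matrix.fromBlocks K 0 0 L).submatrix (sigmaFinAddEquiv k l) (sigmaFinAddEquiv k l),
    (posDef_fromBlocks_zero hK hL).submatrix (sigmaFinAddEquiv k l).injective, fun α => ?_⟩
  have hc : 2 * Real.pi * Real.exp 1 ≠ 0 := by positivity
  rw [Pi.add_apply, hg, hh, det_vPrincipal_fromBlocks, ← mul_add,
    ← Real.logb_mul (mul_ne_zero (pow_ne_zero _ hc) (vPrincipal_posDef hK α).det_pos.ne')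
      (mul_ne_zero (pow_ne_zero _ hc) (vPrincipal_posDef hL α).det_pos.ne'),
    Finset.sum_add_distrib, pow_add]
  ring_nf

theorem IsSGaussian.isVGaussian {n : ℕ} {g : Finset (Fin n) → ℝ} (hg : IsSGaussian n g) :
    IsVGaussian n g := by
  obtain ⟨K, hK, hg⟩ := hg
  let k : Fin n → ℕ := fun _ => 1
  let e : ((i : Fin n) × Fin (k i)) ≃ Fin n := Equiv.sigmaUnique (Fin n) fun _ => Fin 1
  refine ⟨k, fun _ => Nat.one_pos, K.submatrix e e, hK.submatrix e.injective, fun α => ?_⟩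
  let f : {p : (i : Fin n) × Fin (k i) // p.1 ∈ α} ≃ {i // i ∈ α} :=
    e.subtypeEquiv fun _ => Iff.rfl
  have hsub : vPrincipal (K.submatrix e e) α = (principalSub K α).submatrix f f := rfl
  rw [hg, hsub, Matrix.det_submatrix_equiv_self, Finset.card_eq_sum_ones]

/-- `con(Υ_{s,n}) ⊆ W̄(Υ_{v,n})`. -/
theorem stmt11 (n : ℕ) :
    ccc {g : Finset (Fin n) → ℝ | IsSGaussian n g} ⊆
      closure (Wscale {g : Finset (Fin n) → ℝ | IsVGaussian n g}) := by
  refine Set.sInter_subset_of_mem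
    ⟨isClosedConvexCone_closure_Wscale fun _ hg _ hh => IsVGaussian.add hg hh, ?_⟩
  exact fun g hg => subset_closure
    ⟨1, one_pos, g, IsSGaussian.isVGaussian hg, (one_smul ℝ g).symm⟩

end
end

section
/- If g_1 and g_2 are v-entropic functions over N, then g_1 + g_2 is also v-entropic. -/
open MeasureTheory

noncomputable section

/-- Pairing two families coordinatewise, as a measurable equivalence. -/
def prodPiEquivPiProd {ι : Type*} (A B : ι → Type*) [∀ i, MeasurableSpace (A i)]
    [∀ i, MeasurableSpace (B i)] :
    ((∀ i, A i) × (∀ i, B i)) ≃ᵐ (∀ i, A i × B i) where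
  toFun p i := (p.1 i, p.2 i)
  invFun q := (fun i => (q i).1, fun i => (q i).2)
  left_inv _ := rfl
  right_inv _ := rfl
  measurable_toFun := by
    refine measurable_pi_iff.2 fun i => ?_
    exact ((measurable_pi_apply i).comp measurable_fst).prodMk
      ((measurable_pi_apply i).comp measurable_snd)
  measurable_invFun := by
    refine (measurable_pi_iff.2 fun i => ?_).prodMk (measurable_pi_iff.2 fun i => ?_)
    · exact measurable_fst.comp (measurable_pi_apply i)
    · exact measurable_snd.comp (measurable_pi_apply i)

open Set MeasurableSpace in
theorem measurePreserving_prodPiEquivPiProd {ι : Type*} [Fintype ι] (A B : ι → Type*)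
    [∀ i, MeasureSpace (A i)] [∀ i, MeasureSpace (B i)]
    [∀ i, SigmaFinite (volume : Measure (A i))] [∀ i, SigmaFinite (volume : Measure (B i))] :
    MeasurePreserving (prodPiEquivPiProd A B) volume volume where
  measurable := (prodPiEquivPiProd A B).measurable
  map_eq := by
    refine (Measure.pi_eq_generateFrom (fun i => generateFrom_prod)
      (fun i => isPiSystem_prod)
      (fun i => (volume : Measure (A i)).toFiniteSpanningSetsIn.prod
        (volume : Measure (B i)).toFiniteSpanningSetsIn) fun u hu => ?_).symm
    choose s hs t ht hst using hu
    obtain rfl : (fun i => s i ×ˢ t i) = u := funext hst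
    have hpre : prodPiEquivPiProd A B ⁻¹' univ.pi (fun i => s i ×ˢ t i)
        = univ.pi s ×ˢ univ.pi t := by
      ext p
      simp [prodPiEquivPiProd, mem_pi, forall_and]
    rw [MeasurableEquiv.map_apply, hpre, Measure.volume_eq_prod, Measure.prod_prod,
      volume_pi_pi, volume_pi_pi, ← Finset.prod_mul_distrib]
    simp

/-- Concatenation of two real vectors, as a measurable equivalence. -/
def appendEquiv (a b : ℕ) : ((Fin a → ℝ) × (Fin b → ℝ)) ≃ᵐ (Fin (a + b) → ℝ) :=
  (MeasurableEquiv.sumPiEquivProdPi fun _ : Fin a ⊕ Fin b => ℝ).symm.trans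
    (MeasurableEquiv.piCongrLeft (fun _ => ℝ) finSumFinEquiv)

theorem measurePreserving_appendEquiv (a b : ℕ) :
    MeasurePreserving (appendEquiv a b) volume volume :=
  (volume_measurePreserving_piCongrLeft (fun _ => ℝ) finSumFinEquiv).comp
    (volume_measurePreserving_sumPiEquivProdPi_symm fun _ : Fin a ⊕ Fin b => ℝ)

/-- Blockwise concatenation of two families of real vectors, as a measurable equivalence. -/
def blockAppendEquiv {ι : Type*} (a b : ι → ℕ) :
    ((∀ i, Fin (a i) → ℝ) × (∀ i, Fin (b i) → ℝ)) ≃ᵐ (∀ i, Fin (a i + b i) → ℝ) :=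
  (prodPiEquivPiProd _ _).trans (MeasurableEquiv.piCongrRight fun i => appendEquiv (a i) (b i))

theorem measurePreserving_blockAppendEquiv {ι : Type*} [Fintype ι] (a b : ι → ℕ) :
    MeasurePreserving (blockAppendEquiv a b) volume volume :=
  (volume_preserving_pi fun i => measurePreserving_appendEquiv (a i) (b i)).comp
    (measurePreserving_prodPiEquivPiProd _ _)

section ProductDensity

variable {Ω₁ Ω₂ E₁ E₂ E : Type*} [MeasurableSpace Ω₁] [MeasurableSpace Ω₂]
  [MeasureSpace E₁] [MeasureSpace E₂] [MeasureSpace E]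

theorem map_prod_eq_withDensity [SFinite (volume : Measure E₂)] {P₁ : Measure Ω₁} {P₂ : Measure Ω₂}
    [SFinite P₁] [SFinite P₂] {Y₁ : Ω₁ → E₁} {Y₂ : Ω₂ → E₂}
    (hY₁ : Measurable Y₁) (hY₂ : Measurable Y₂) {f₁ : E₁ → ℝ} {f₂ : E₂ → ℝ}
    (hf₁ : Measurable f₁) (hf₂ : Measurable f₂) (hf₁0 : ∀ x, 0 ≤ f₁ x)
    (h₁ : P₁.map Y₁ = volume.withDensity fun x => ENNReal.ofReal (f₁ x))
    (h₂ : P₂.map Y₂ = volume.withDensity fun x => ENNReal.ofReal (f₂ x))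
    (e : E₁ × E₂ ≃ᵐ E) (he : MeasurePreserving e volume volume) :
    (P₁.prod P₂).map (fun ω => e (Y₁ ω.1, Y₂ ω.2)) =
      volume.withDensity fun x => ENNReal.ofReal (f₁ (e.symm x).1 * f₂ (e.symm x).2) := by
  have hcomp : (fun ω : Ω₁ × Ω₂ => e (Y₁ ω.1, Y₂ ω.2)) = e ∘ Prod.map Y₁ Y₂ := rfl
  rw [hcomp, ← Measure.map_map e.measurable (hY₁.prodMap hY₂),
    ← Measure.map_prod_map P₁ P₂ hY₁ hY₂, h₁, h₂,
    prod_withDensity hf₁.ennreal_ofReal hf₂.ennreal_ofReal]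
  ext s hs
  rw [MeasurableEquiv.map_apply, withDensity_apply _ hs,
    withDensity_apply _ (e.measurable hs), ← Measure.volume_eq_prod,
    ← he.setLIntegral_comp_preimage_emb e.measurableEmbedding]
  simp [ENNReal.ofReal_mul (hf₁0 _)]

theorem integral_eq_one_of_map_eq_withDensity {P : Measure Ω₁} [IsProbabilityMeasure P]
    {Y : Ω₁ → E₁} (hY : Measurable Y) {f : E₁ → ℝ} (hf : Measurable f) (hf0 : ∀ x, 0 ≤ f x)
    (h : P.map Y = volume.withDensity fun x => ENNReal.ofReal (f x)) :
    Integrable f ∧ ∫ x, f x = 1 := by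
  have := Measure.isProbabilityMeasure_map (μ := P) hY.aemeasurable
  have hl : ∫⁻ x, ENNReal.ofReal (f x) = 1 := by
    rw [← setLIntegral_univ, ← withDensity_apply _ MeasurableSet.univ, ← h, measure_univ]
  constructor
  · refine ⟨hf.aestronglyMeasurable, ?_⟩
    rw [hasFiniteIntegral_iff_ofReal (.of_forall hf0), hl]
    exact ENNReal.one_lt_top
  · rw [integral_eq_lintegral_of_nonneg_ae (.of_forall hf0) hf.aestronglyMeasurable, hl,
      ENNReal.toReal_one]

theorem integral_mul_logb_prod [SFinite (volume : Measure E₁)]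
    [SFinite (volume : Measure E₂)] {f₁ : E₁ → ℝ} {f₂ : E₂ → ℝ}
    (h₁ : Integrable f₁ ∧ ∫ x, f₁ x = 1) (h₂ : Integrable f₂ ∧ ∫ x, f₂ x = 1)
    (hl₁ : Integrable fun x => f₁ x * Real.logb 2 (f₁ x))
    (hl₂ : Integrable fun x => f₂ x * Real.logb 2 (f₂ x))
    (e : E₁ × E₂ ≃ᵐ E) (he : MeasurePreserving e volume volume) :
    (Integrable fun x => (f₁ (e.symm x).1 * f₂ (e.symm x).2) *
        Real.logb 2 (f₁ (e.symm x).1 * f₂ (e.symm x).2)) ∧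
      ∫ x, (f₁ (e.symm x).1 * f₂ (e.symm x).2) *
          Real.logb 2 (f₁ (e.symm x).1 * f₂ (e.symm x).2) =
        (∫ x, f₁ x * Real.logb 2 (f₁ x)) + ∫ x, f₂ x * Real.logb 2 (f₂ x) := by
  set F : E₁ × E₂ → ℝ := fun p => (f₁ p.1 * f₂ p.2) * Real.logb 2 (f₁ p.1 * f₂ p.2) with hF
  have hsplit : F = fun p => (f₁ p.1 * Real.logb 2 (f₁ p.1)) * f₂ p.2 +
      f₁ p.1 * (f₂ p.2 * Real.logb 2 (f₂ p.2)) := by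
    funext p
    rcases eq_or_ne (f₁ p.1) 0 with h | h
    · simp [hF, h]
    rcases eq_or_ne (f₂ p.2) 0 with h' | h'
    · simp [hF, h']
    simp only [hF, Real.logb_mul h h']
    ring
  have hi₁ : Integrable (fun p : E₁ × E₂ => (f₁ p.1 * Real.logb 2 (f₁ p.1)) * f₂ p.2) :=
    hl₁.mul_prod h₂.1
  have hi₂ : Integrable (fun p : E₁ × E₂ => f₁ p.1 * (f₂ p.2 * Real.logb 2 (f₂ p.2))) :=
    h₁.1.mul_prod hl₂
  have hFi : Integrable F := hsplit ▸ hi₁.add hi₂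
  refine ⟨(he.symm e).integrable_comp_of_integrable hFi, ?_⟩
  have hint : ∫ x, F (e.symm x) = ∫ p, F p := (he.symm e).integral_comp' F
  refine hint.trans ?_
  rw [hsplit, integral_add hi₁ hi₂, Measure.volume_eq_prod,
    integral_prod_mul (fun x => f₁ x * Real.logb 2 (f₁ x)) f₂,
    integral_prod_mul f₁ (fun x => f₂ x * Real.logb 2 (f₂ x)), h₁.2, h₂.2, mul_one, one_mul]

end ProductDensity

/-- if `g₁` and `g₂` are v-entropic, then so is `g₁ + g₂`. -/
theorem stmt13 (n : ℕ) (g₁ g₂ : Finset (Fin n) → ℝ)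
    (h₁ : IsVEntropic n g₁) (h₂ : IsVEntropic n g₂) :
    IsVEntropic n (g₁ + g₂) := by
  obtain ⟨k₁, hk₁, Ω₁, m₁, X₁, hP₁, hX₁, ⟨f₁, hf₁, hf₁0, hd₁⟩, hg₁, H₁⟩ := h₁
  obtain ⟨k₂, hk₂, Ω₂, m₂, X₂, hP₂, hX₂, ⟨f₂, hf₂, hf₂0, hd₂⟩, hg₂, H₂⟩ := h₂
  refine ⟨fun i => k₁ i + k₂ i, fun i => Nat.add_pos_left (hk₁ i) _, Ω₁ × Ω₂, inferInstance,
    fun i ω => appendEquiv (k₁ i) (k₂ i) (X₁ i ω.1, X₂ i ω.2), ?_, ?_, ?_, ?_, ?_⟩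
  · rw [Measure.volume_eq_prod]
    infer_instance
  · exact (blockAppendEquiv k₁ k₂).measurable.comp
      ((hX₁.comp measurable_fst).prodMk (hX₂.comp measurable_snd))
  · let e := blockAppendEquiv k₁ k₂
    refine ⟨fun x => f₁ (e.symm x).1 * f₂ (e.symm x).2, ?_,
      fun x => mul_nonneg (hf₁0 _) (hf₂0 _), ?_⟩
    · exact (hf₁.comp (measurable_fst.comp e.symm.measurable)).mul
        (hf₂.comp (measurable_snd.comp e.symm.measurable))
    · exact map_prod_eq_withDensity hX₁ hX₂ hf₁ hf₂ hf₁0 hd₁ hd₂ e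
        (measurePreserving_blockAppendEquiv k₁ k₂)
  · simp [hg₁, hg₂]
  · intro α hα
    obtain ⟨f₁, hf₁, hf₁0, hd₁, hi₁, he₁⟩ := H₁ α hα
    obtain ⟨f₂, hf₂, hf₂0, hd₂, hi₂, he₂⟩ := H₂ α hα
    let e := blockAppendEquiv (fun i : {i // i ∈ α} => k₁ i.1) fun i : {i // i ∈ α} => k₂ i.1
    have he : MeasurePreserving e volume volume := measurePreserving_blockAppendEquiv _ _
    have hY₁ : Measurable fun ω (i : {i // i ∈ α}) => X₁ i.1 ω :=
      measurable_pi_iff.2 fun i => measurable_pi_iff.1 hX₁ i.1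
    have hY₂ : Measurable fun ω (i : {i // i ∈ α}) => X₂ i.1 ω :=
      measurable_pi_iff.2 fun i => measurable_pi_iff.1 hX₂ i.1
    obtain ⟨hint, heq⟩ := integral_mul_logb_prod
      (integral_eq_one_of_map_eq_withDensity hY₁ hf₁ hf₁0 hd₁)
      (integral_eq_one_of_map_eq_withDensity hY₂ hf₂ hf₂0 hd₂) hi₁ hi₂ e he
    refine ⟨fun x => f₁ (e.symm x).1 * f₂ (e.symm x).2, ?_,
      fun x => mul_nonneg (hf₁0 _) (hf₂0 _), ?_, hint, ?_⟩
    · exact (hf₁.comp (measurable_fst.comp e.symm.measurable)).mul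
        (hf₂.comp (measurable_snd.comp e.symm.measurable))
    · exact map_prod_eq_withDensity hY₁ hY₂ hf₁ hf₂ hf₁0 hd₁ hd₂ e he
    · rw [heq, Pi.add_apply, he₁, he₂, neg_add]

end
end

section
/- If g is a v-entropic function, then for every real c > 0 the function c·g lies in the closure of the set of v-entropic functions: c·g ∈ closure(γ*_{v,n}). -/
open MeasureTheory

noncomputable section

/-- `ν` has a density on `E` whose base-2 differential entropy exists and equals `h`. -/
def HasEntropy {E : Type*} [MeasureSpace E] (ν : Measure E) (h : ℝ) : Prop :=
  ∃ f : E → ℝ, Measurable f ∧ (∀ x, 0 ≤ f x) ∧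
    ν = volume.withDensity (fun x => ENNReal.ofReal (f x)) ∧
    Integrable (fun x => f x * Real.logb 2 (f x)) ∧
    h = -∫ x, f x * Real.logb 2 (f x)

theorem integrable_of_withDensity_ofReal {E : Type*} [MeasureSpace E] {ν : Measure E}
    [IsFiniteMeasure ν] {f : E → ℝ} (hf : Measurable f)
    (hν : ν = volume.withDensity (fun x => ENNReal.ofReal (f x))) (h0 : ∀ x, 0 ≤ f x) :
    Integrable f := by
  refine ⟨hf.aestronglyMeasurable, ?_⟩
  rw [hasFiniteIntegral_iff_ofReal (Filter.Eventually.of_forall h0),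
    ← setLIntegral_univ, ← withDensity_apply _ MeasurableSet.univ, ← hν]
  exact measure_lt_top ν _

theorem integral_of_withDensity_ofReal {E : Type*} [MeasureSpace E] {ν : Measure E}
    [IsProbabilityMeasure ν] {f : E → ℝ} (hf : Measurable f)
    (hν : ν = volume.withDensity (fun x => ENNReal.ofReal (f x))) (h0 : ∀ x, 0 ≤ f x) :
    ∫ x, f x = 1 := by
  rw [integral_eq_lintegral_of_nonneg_ae (Filter.Eventually.of_forall h0)
    hf.aestronglyMeasurable, ← setLIntegral_univ, ← withDensity_apply _ MeasurableSet.univ, ← hν]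
  simp

theorem exists_density_of_absolutelyContinuous {E : Type*} [MeasureSpace E]
    [SigmaFinite (volume : Measure E)] {ν : Measure E} [IsFiniteMeasure ν] (hν : ν ≪ volume) :
    ∃ f : E → ℝ, Measurable f ∧ (∀ x, 0 ≤ f x) ∧
      ν = volume.withDensity (fun x => ENNReal.ofReal (f x)) := by
  refine ⟨fun x => (ν.rnDeriv volume x).toReal, (Measure.measurable_rnDeriv _ _).ennreal_toReal,
    fun _ => ENNReal.toReal_nonneg, ?_⟩
  conv_lhs => rw [← Measure.withDensity_rnDeriv_eq _ _ hν]
  refine withDensity_congr_ae ?_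
  filter_upwards [Measure.rnDeriv_lt_top ν volume] with x hx
  rw [ENNReal.ofReal_toReal hx.ne]

theorem HasEntropy.map_measurableEquiv {E F : Type*} [MeasureSpace E] [MeasureSpace F]
    {ν : Measure E} {h : ℝ} (hν : HasEntropy ν h) (e : E ≃ᵐ F) (he : MeasurePreserving e) :
    HasEntropy (ν.map e) h := by
  obtain ⟨f, hf, h0, hd, hi, hh⟩ := hν
  have hs := he.symm e
  refine ⟨f ∘ e.symm, hf.comp e.symm.measurable, fun x => h0 _, ?_, ?_, ?_⟩
  · ext s hs'
    rw [e.map_apply, hd, withDensity_apply _ (e.measurable hs'), withDensity_apply _ hs',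
      ← he.setLIntegral_comp_preimage hs'
        (hf.comp e.symm.measurable).ennreal_ofReal]
    simp
  · exact (hs.integrable_comp_emb e.symm.measurableEmbedding).2 hi
  · rw [hh]
    congr 1
    exact (hs.integral_comp e.symm.measurableEmbedding
      (fun x => f x * Real.logb 2 (f x))).symm

theorem mul_mul_logb_mul (a b : ℝ) :
    a * b * Real.logb 2 (a * b) = a * Real.logb 2 a * b + a * (b * Real.logb 2 b) := by
  rcases eq_or_ne a 0 with rfl | ha
  · simp
  rcases eq_or_ne b 0 with rfl | hb
  · simp
  rw [Real.logb_mul ha hb]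
  ring

theorem HasEntropy.prod {E F : Type*} [MeasureSpace E] [MeasureSpace F]
    [SigmaFinite (volume : Measure E)] [SigmaFinite (volume : Measure F)]
    {ν : Measure E} {ξ : Measure F} [IsProbabilityMeasure ν] [IsProbabilityMeasure ξ]
    {h₁ h₂ : ℝ} (hν : HasEntropy ν h₁) (hξ : HasEntropy ξ h₂) :
    HasEntropy (ν.prod ξ) (h₁ + h₂) := by
  obtain ⟨f, hf, hf0, hfd, hfi, rfl⟩ := hν
  obtain ⟨u, hu, hu0, hud, hui, rfl⟩ := hξ
  have If := integrable_of_withDensity_ofReal hf hfd hf0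
  have Iu := integrable_of_withDensity_ofReal hu hud hu0
  have I₁ := hfi.mul_prod Iu
  have I₂ := If.mul_prod hui
  refine ⟨fun z => f z.1 * u z.2, by fun_prop, fun z => mul_nonneg (hf0 _) (hu0 _), ?_, ?_, ?_⟩
  · conv_lhs => rw [hfd, hud]
    rw [prod_withDensity hf.ennreal_ofReal hu.ennreal_ofReal]
    simp_rw [← ENNReal.ofReal_mul (hf0 _)]
    rfl
  · simp_rw [mul_mul_logb_mul]
    exact I₁.add I₂
  · simp_rw [mul_mul_logb_mul]
    have := integral_add I₁ I₂
    rw [Measure.volume_eq_prod, this, integral_prod_mul (fun x => f x * Real.logb 2 (f x)) u,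
      integral_prod_mul f (fun y => u y * Real.logb 2 (u y)),
      integral_of_withDensity_ofReal hf hfd hf0, integral_of_withDensity_ofReal hu hud hu0]
    ring

theorem mul_logb_add_le {a b : ℝ} (ha : 0 ≤ a) (hb : 0 ≤ b) :
    a * Real.logb 2 a + b * Real.logb 2 b ≤ (a + b) * Real.logb 2 (a + b) := by
  have key : ∀ x y : ℝ, 0 ≤ x → 0 ≤ y → x * Real.logb 2 x ≤ x * Real.logb 2 (x + y) := by
    intro x y hx hy
    rcases hx.eq_or_lt with rfl | hx'
    · simp
    · exact mul_le_mul_of_nonneg_left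
        (Real.logb_le_logb_of_le one_lt_two hx' (by linarith)) hx
  have h₁ := key a b ha hb
  have h₂ := key b a hb ha
  rw [add_comm b a] at h₂
  linarith [add_mul a b (Real.logb 2 (a + b))]

theorem mul_logb_convex {p a b : ℝ} (hp0 : 0 ≤ p) (hp1 : p ≤ 1) (ha : 0 ≤ a) (hb : 0 ≤ b) :
    (p * a + (1 - p) * b) * Real.logb 2 (p * a + (1 - p) * b) ≤
      p * (a * Real.logb 2 a) + (1 - p) * (b * Real.logb 2 b) := by
  have h := Real.convexOn_mul_log.2 (Set.mem_Ici.2 ha) (Set.mem_Ici.2 hb) hp0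
    (sub_nonneg.2 hp1) (by ring)
  have h2 : 0 < Real.log 2 := Real.log_pos one_lt_two
  simp only [smul_eq_mul] at h
  simp only [Real.logb]
  rw [← mul_div_assoc]
  exact (div_le_div_of_nonneg_right h h2.le).trans_eq (by ring)

/-- Mixing a density with a uniform density on a set of measure one scales the entropy,
up to the binary entropy of the mixing weight. -/
theorem HasEntropy.exists_mix {E : Type*} [MeasureSpace E]
    {ν : Measure E} [IsProbabilityMeasure ν] {h : ℝ} (hν : HasEntropy ν h)
    {A : Set E} (hA : MeasurableSet A) (hA1 : volume A = 1)
    {p : ℝ} (hp0 : 0 ≤ p) (hp1 : p ≤ 1) :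
    ∃ h', HasEntropy
        (ENNReal.ofReal p • ν + ENNReal.ofReal (1 - p) • volume.restrict A) h' ∧
      p * h ≤ h' ∧ h' ≤ p * h + Real.binEntropy p / Real.log 2 := by
  obtain ⟨f, hf, h0, hd, hi, rfl⟩ := hν
  have hq0 : 0 ≤ 1 - p := sub_nonneg.2 hp1
  set u : E → ℝ := A.indicator 1 with hu_def
  have hu : Measurable u := measurable_one.indicator hA
  have hu0 : ∀ x, 0 ≤ u x := fun x => Set.indicator_nonneg (fun _ _ => zero_le_one) x
  have hu_log : ∀ x, u x * Real.logb 2 (u x) = 0 := fun x => by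
    by_cases hx : x ∈ A <;> simp [hu_def, hx]
  have hud : volume.restrict A = volume.withDensity (fun x => ENNReal.ofReal (u x)) := by
    rw [← withDensity_indicator_one hA]
    congr 1
    ext x
    by_cases hx : x ∈ A <;> simp [hu_def, hx]
  have : IsProbabilityMeasure ((volume : Measure E).restrict A) := ⟨by simp [hA1]⟩
  have If := integrable_of_withDensity_ofReal hf hd h0
  have Iu := integrable_of_withDensity_ofReal hu hud hu0
  have hf1 := integral_of_withDensity_ofReal hf hd h0
  have hu1 := integral_of_withDensity_ofReal hu hud hu0
  set v : E → ℝ := fun x => p * f x + (1 - p) * u x with hv_def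
  have hv : Measurable v := by fun_prop
  have hv0 : ∀ x, 0 ≤ v x := fun x =>
    add_nonneg (mul_nonneg hp0 (h0 x)) (mul_nonneg hq0 (hu0 x))
  have hup : ∀ x, v x * Real.logb 2 (v x) ≤ p * (f x * Real.logb 2 (f x)) := fun x => by
    have := mul_logb_convex hp0 hp1 (h0 x) (hu0 x)
    rwa [hu_log, mul_zero, add_zero] at this
  have hlo : ∀ x, p * (f x * Real.logb 2 (f x)) + (p * Real.logb 2 p * f x
      + (1 - p) * Real.logb 2 (1 - p) * u x) ≤ v x * Real.logb 2 (v x) := fun x => by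
    have := mul_logb_add_le (mul_nonneg hp0 (h0 x)) (mul_nonneg hq0 (hu0 x))
    rw [mul_mul_logb_mul, mul_mul_logb_mul, hu_log, mul_zero, add_zero] at this
    linarith
  have Iup := hi.const_mul p
  have Iq := (If.const_mul (p * Real.logb 2 p)).add (Iu.const_mul ((1 - p) * Real.logb 2 (1 - p)))
  have Ilo := Iup.add Iq
  have hvm : Measurable fun x => v x * Real.logb 2 (v x) :=
    hv.mul ((Real.measurable_log.comp hv).div_const _)
  have Iv : Integrable fun x => v x * Real.logb 2 (v x) :=
    integrable_of_le_of_le hvm.aestronglyMeasurable (Filter.Eventually.of_forall hlo)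
      (Filter.Eventually.of_forall hup) Ilo Iup
  refine ⟨-∫ x, v x * Real.logb 2 (v x), ⟨v, hv, hv0, ?_, Iv, rfl⟩, ?_, ?_⟩
  · rw [hd, hud, ← withDensity_smul _ hf.ennreal_ofReal, ← withDensity_smul _ hu.ennreal_ofReal,
      ← withDensity_add_left (hf.ennreal_ofReal.const_smul _)]
    congr 1
    ext x
    simp only [Pi.add_apply, Pi.smul_apply, smul_eq_mul, hv_def]
    rw [ENNReal.ofReal_add (mul_nonneg hp0 (h0 x)) (mul_nonneg hq0 (hu0 x)),
      ENNReal.ofReal_mul hp0, ENNReal.ofReal_mul hq0]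
  · have := integral_mono Iv Iup hup
    rw [integral_const_mul] at this
    linarith
  · have := integral_mono Ilo Iv hlo
    rw [integral_add' Iup Iq, integral_add' (If.const_mul _) (Iu.const_mul _)] at this
    simp only [integral_const_mul, hf1, hu1] at this
    have hb : Real.binEntropy p / Real.log 2 =
        -(p * Real.logb 2 p + (1 - p) * Real.logb 2 (1 - p)) := by
      rw [Real.binEntropy_eq_negMulLog_add_negMulLog_one_sub]
      simp only [Real.negMulLog, Real.logb]
      ring
    rw [hb]
    linarith

/-- Concatenation of real vectors, as a measurable equivalence. -/
def appendMeasurableEquiv (m n : ℕ) : (Fin m → ℝ) × (Fin n → ℝ) ≃ᵐ (Fin (m + n) → ℝ) :=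
  (Fin.appendHomeomorph m n).toMeasurableEquiv

theorem measurePreserving_appendMeasurableEquiv (m n : ℕ) :
    MeasurePreserving (appendMeasurableEquiv m n) where
  measurable := (appendMeasurableEquiv m n).measurable
  map_eq := by
    refine (Measure.pi_eq fun s _ => ?_).symm
    have : appendMeasurableEquiv m n ⁻¹' Set.univ.pi s =
        (Set.univ.pi fun i => s (Fin.castAdd n i)) ×ˢ
          (Set.univ.pi fun i => s (Fin.natAdd m i)) := by
      ext z
      have : appendMeasurableEquiv m n z = Fin.append z.1 z.2 := rfl
      simp [Set.mem_pi, this, Fin.forall_fin_add]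
    rw [MeasurableEquiv.map_apply, this, Measure.volume_eq_prod, Measure.prod_prod, volume_pi,
      volume_pi, Measure.pi_pi, Measure.pi_pi, Fin.prod_univ_add]

section PiProd

variable {ι : Type*} (E F : ι → Type*)

/-- A pair of families is the same as a family of pairs, as a measurable equivalence. -/
def piProdMeasurableEquiv [∀ i, MeasurableSpace (E i)] [∀ i, MeasurableSpace (F i)] :
    (∀ i, E i × F i) ≃ᵐ (∀ i, E i) × (∀ i, F i) where
  __ := Equiv.arrowProdEquivProdArrow ι E F
  measurable_toFun := by
    dsimp [Equiv.arrowProdEquivProdArrow]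
    fun_prop
  measurable_invFun := by
    dsimp [Equiv.arrowProdEquivProdArrow]
    fun_prop

theorem measurePreserving_piProdMeasurableEquiv [Fintype ι] [∀ i, MeasureSpace (E i)]
    [∀ i, MeasureSpace (F i)] [∀ i, SigmaFinite (volume : Measure (E i))]
    [∀ i, SigmaFinite (volume : Measure (F i))] :
    MeasurePreserving (piProdMeasurableEquiv E F) where
  measurable := (piProdMeasurableEquiv E F).measurable
  map_eq := by
    let a (i : ι) := (volume : Measure (E i)).toFiniteSpanningSetsIn
    let b (i : ι) := (volume : Measure (F i)).toFiniteSpanningSetsIn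
    refine (Measure.FiniteSpanningSetsIn.ext ?_ (isPiSystem_pi.prod isPiSystem_pi)
      ((Measure.FiniteSpanningSetsIn.pi a).prod (Measure.FiniteSpanningSetsIn.pi b)) ?_).symm
    · exact (generateFrom_eq_prod generateFrom_pi generateFrom_pi
        (Measure.FiniteSpanningSetsIn.pi a).isCountablySpanning
        (Measure.FiniteSpanningSetsIn.pi b).isCountablySpanning).symm
    · rintro _ ⟨s, ⟨s, _, rfl⟩, ⟨_, ⟨t, _, rfl⟩, rfl⟩⟩
      rw [MeasurableEquiv.map_apply]
      rw [show piProdMeasurableEquiv E F ⁻¹' (Set.univ.pi s ×ˢ Set.univ.pi t) =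
          (Set.univ.pi fun i ↦ s i ×ˢ t i) by
          ext; simp [piProdMeasurableEquiv, Equiv.arrowProdEquivProdArrow, Set.mem_pi, forall_and]]
      simp_rw [volume_pi, Measure.pi_pi, Measure.volume_eq_prod, Measure.prod_prod,
        Measure.pi_pi, Finset.prod_mul_distrib]

end PiProd

/-- Blockwise concatenation of two families of real vectors. -/
def blockAppend {ι : Type*} (k l : ι → ℕ) :
    (∀ i, Fin (k i) → ℝ) × (∀ i, Fin (l i) → ℝ) ≃ᵐ (∀ i, Fin (k i + l i) → ℝ) :=
  (piProdMeasurableEquiv _ _).symm.trans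
    (MeasurableEquiv.piCongrRight fun i => appendMeasurableEquiv (k i) (l i))

theorem measurePreserving_blockAppend {ι : Type*} [Fintype ι] (k l : ι → ℕ) :
    MeasurePreserving (blockAppend k l) :=
  (volume_preserving_pi fun i => measurePreserving_appendMeasurableEquiv (k i) (l i)).comp
    ((measurePreserving_piProdMeasurableEquiv _ _).symm _)

theorem isVEntropic_iff {n : ℕ} {g : Finset (Fin n) → ℝ} :
    IsVEntropic n g ↔ ∃ k : Fin n → ℕ, (∀ i, 0 < k i) ∧
      ∃ μ : Measure ((i : Fin n) → Fin (k i) → ℝ), IsProbabilityMeasure μ ∧ μ ≪ volume ∧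
        g ∅ = 0 ∧ ∀ α : Finset (Fin n), α.Nonempty → HasEntropy (μ.map α.restrict) (g α) := by
  constructor
  · rintro ⟨k, hk, Ω, m, X, hprob, hX, ⟨f, -, -, hfd⟩, hg0, hg⟩
    refine ⟨k, hk, volume.map fun ω i => X i ω, Measure.isProbabilityMeasure_map hX.aemeasurable,
      ?_, hg0, fun α hα => ?_⟩
    · rw [hfd]
      exact withDensity_absolutelyContinuous _ _
    · rw [Measure.map_map (Finset.measurable_restrict α) hX]
      exact hg α hα
  · rintro ⟨k, hk, μ, hμ, hac, hg0, hg⟩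
    refine ⟨k, hk, (i : Fin n) → Fin (k i) → ℝ, ⟨μ⟩, fun i x => x i, hμ, measurable_id, ?_, hg0, hg⟩
    obtain ⟨f, hf, hf0, hfd⟩ := exists_density_of_absolutelyContinuous hac
    exact ⟨f, hf, hf0, Measure.map_id.trans hfd⟩

theorem IsVEntropic.add {n : ℕ} {g₁ g₂ : Finset (Fin n) → ℝ} (h₁ : IsVEntropic n g₁)
    (h₂ : IsVEntropic n g₂) : IsVEntropic n (g₁ + g₂) := by
  obtain ⟨k, hk, μ, hμ, hμac, hμ0, hμe⟩ := isVEntropic_iff.1 h₁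
  obtain ⟨l, hl, ν, hν, hνac, hν0, hνe⟩ := isVEntropic_iff.1 h₂
  refine isVEntropic_iff.2 ⟨fun i => k i + l i, fun i => Nat.add_pos_left (hk i) _,
    (μ.prod ν).map (blockAppend k l),
    Measure.isProbabilityMeasure_map (blockAppend k l).measurable.aemeasurable, ?_, ?_, ?_⟩
  · rw [← (measurePreserving_blockAppend k l).map_eq]
    exact (hμac.prod hνac).map (blockAppend k l).measurable
  · simp [hμ0, hν0]
  · intro α hα
    have mk : Measurable (α.restrict : (∀ i, Fin (k i) → ℝ) → _) := Finset.measurable_restrict α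
    have ml : Measurable (α.restrict : (∀ i, Fin (l i) → ℝ) → _) := Finset.measurable_restrict α
    have := Measure.isProbabilityMeasure_map (μ := μ) mk.aemeasurable
    have := Measure.isProbabilityMeasure_map (μ := ν) ml.aemeasurable
    have key := ((hμe α hα).prod (hνe α hα)).map_measurableEquiv _
      (measurePreserving_blockAppend (fun i : α => k i) (fun i : α => l i))
    rw [Measure.map_prod_map _ _ mk ml, Measure.map_map (by fun_prop) (mk.prodMap ml)] at key
    rw [Measure.map_map (Finset.measurable_restrict α) (by fun_prop)]
    exact key

theorem IsVEntropic.nsmul {n : ℕ} {g : Finset (Fin n) → ℝ} (hg : IsVEntropic n g) (m : ℕ) :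
    IsVEntropic n ((m + 1) • g) := by
  induction m with
  | zero => simpa using hg
  | succ m ih => rw [succ_nsmul]; exact ih.add hg

/-- The unit cube in a product of real coordinate spaces. -/
def unitCube {ι : Type*} (k : ι → ℕ) : Set (∀ i, Fin (k i) → ℝ) :=
  Set.univ.pi fun _ => Set.univ.pi fun _ => Set.Icc 0 1

theorem volume_univ_pi_Icc_zero_one (k : ℕ) :
    volume (Set.univ.pi fun _ : Fin k => Set.Icc (0 : ℝ) 1) = 1 := by
  rw [volume_pi, Measure.pi_pi]
  simp

theorem measurableSet_unitCube {ι : Type*} [Countable ι] (k : ι → ℕ) :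
    MeasurableSet (unitCube k) :=
  .univ_pi fun _ => .univ_pi fun _ => measurableSet_Icc

theorem volume_unitCube {ι : Type*} [Fintype ι] (k : ι → ℕ) : volume (unitCube k) = 1 := by
  rw [unitCube, volume_pi, Measure.pi_pi]
  simp only [volume_univ_pi_Icc_zero_one, Finset.prod_const_one]

theorem map_restrict_volume_unitCube {n : ℕ} (k : Fin n → ℕ) (α : Finset (Fin n)) :
    (volume.restrict (unitCube k)).map α.restrict =
      volume.restrict (unitCube fun i : α => k i) := by
  have (i : Fin n) : IsProbabilityMeasure
      ((volume : Measure (Fin (k i) → ℝ)).restrict (Set.univ.pi fun _ => Set.Icc 0 1)) :=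
    ⟨by rw [Measure.restrict_apply_univ, volume_univ_pi_Icc_zero_one]⟩
  rw [unitCube, unitCube, volume_pi, volume_pi, Measure.restrict_pi_pi, Measure.restrict_pi_pi,
    ← Measure.infinitePi_eq_pi, Measure.infinitePi_map_restrict]

theorem IsVEntropic.exists_mix {n : ℕ} {g : Finset (Fin n) → ℝ} (hg : IsVEntropic n g)
    {p : ℝ} (hp0 : 0 ≤ p) (hp1 : p ≤ 1) :
    ∃ g', IsVEntropic n g' ∧
      ∀ α, p * g α ≤ g' α ∧ g' α ≤ p * g α + Real.binEntropy p / Real.log 2 := by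
  classical
  obtain ⟨k, hk, μ, hμ, hac, hg0, he⟩ := isVEntropic_iff.1 hg
  have mr (α : Finset (Fin n)) : Measurable (α.restrict : (∀ i, Fin (k i) → ℝ) → _) :=
    Finset.measurable_restrict α
  have (α : Finset (Fin n)) := Measure.isProbabilityMeasure_map (μ := μ) (mr α).aemeasurable
  have mix (α : Finset (Fin n)) (hα : α.Nonempty) := (he α hα).exists_mix
    (measurableSet_unitCube _) (volume_unitCube fun i : α => k i) hp0 hp1
  choose h' hh' hle hge using mix
  refine ⟨fun α => if hα : α.Nonempty then h' α hα else 0, isVEntropic_iff.2 ⟨k, hk,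
    ENNReal.ofReal p • μ + ENNReal.ofReal (1 - p) • volume.restrict (unitCube k), ?_, ?_, ?_, ?_⟩,
    fun α => ?_⟩
  · constructor
    simp only [Measure.add_apply, Measure.smul_apply, measure_univ, smul_eq_mul, mul_one,
      Measure.restrict_apply_univ, volume_unitCube]
    rw [← ENNReal.ofReal_add hp0 (sub_nonneg.2 hp1)]
    simp
  · exact (hac.smul_left _).add_left (Measure.restrict_le_self.absolutelyContinuous.smul_left _)
  · simp
  · intro α hα
    rw [Measure.map_add _ _ (mr α), Measure.map_smul, Measure.map_smul,
      map_restrict_volume_unitCube]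
    simpa [hα] using hh' α hα
  · by_cases hα : α.Nonempty
    · simpa [hα] using ⟨hle α hα, hge α hα⟩
    · have := div_nonneg (Real.binEntropy_nonneg hp0 hp1) (Real.log_pos one_lt_two).le
      obtain rfl := Finset.not_nonempty_iff_eq_empty.1 hα
      simpa [hg0] using this

/-- if `g` is v-entropic, then for every `c > 0`,
`c·g ∈ closure(γ*_{v,n})`. -/
theorem stmt14 (n : ℕ) (g : Finset (Fin n) → ℝ) (hg : IsVEntropic n g)
    (c : ℝ) (hc : 0 < c) :
    c • g ∈ closure {g' : Finset (Fin n) → ℝ | IsVEntropic n g'} := by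
  let p (m : ℕ) : ℝ := c / (m + 1 + c)
  have hp0 (m : ℕ) : 0 ≤ p m := by positivity
  have hp1 (m : ℕ) : p m ≤ 1 := div_le_one_of_le₀ (by linarith [m.cast_nonneg (α := ℝ)])
    (by positivity)
  choose g' hg' hlo hup using fun m => by
    simpa only [forall_and] using (hg.nsmul m).exists_mix (hp0 m) (hp1 m)
  have hp : Filter.Tendsto p Filter.atTop (nhds 0) :=
    tendsto_const_nhds.div_atTop <| Filter.tendsto_atTop_add_const_right _ _ <|
      Filter.tendsto_atTop_add_const_right _ _ tendsto_natCast_atTop_atTop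
  have hpm : Filter.Tendsto (fun m : ℕ => p m * (m + 1)) Filter.atTop (nhds c) := by
    have h (m : ℕ) : p m * (m + 1) = c - c * p m := by
      simp only [p]
      field_simp
      ring
    simpa [h] using (hp.const_mul c).const_sub c
  refine mem_closure_of_tendsto (f := g') (b := Filter.atTop) ?_
    (Filter.Eventually.of_forall hg')
  refine tendsto_pi_nhds.2 fun α => ?_
  have hlim : Filter.Tendsto (fun m => p m * ((m + 1) • g) α) Filter.atTop (nhds ((c • g) α)) := by
    simpa [mul_assoc] using hpm.mul_const (g α)
  have hb : Filter.Tendsto (fun m => Real.binEntropy (p m) / Real.log 2) Filter.atTop (nhds 0) := by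
    simpa using ((Real.binEntropy_continuous.tendsto 0).comp hp).div_const (Real.log 2)
  exact tendsto_of_tendsto_of_tendsto_of_le_of_le hlim (by simpa using hlim.add hb)
    (fun m => hlo m α) (fun m => hup m α)

end
end

section
/- The closure of the set of v-entropic functions, closure(γ*_{v,n}), is a closed convex cone: it is closed under addition and under multiplication by nonnegative real scalars. -/
open MeasureTheory

noncomputable section

/-- `f` is a measurable, nonnegative density of `ν` with respect to `μ`. -/
def IsDensity {E : Type*} [MeasurableSpace E] (μ ν : Measure E) (f : E → ℝ) : Prop :=
  Measurable f ∧ (∀ x, 0 ≤ f x) ∧ ν = μ.withDensity fun x => ENNReal.ofReal (f x)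

/-- `ν` has a density with respect to `μ` whose differential entropy (base 2) is `h`. -/
def HasDiffEntropy {E : Type*} [MeasurableSpace E] (μ ν : Measure E) (h : ℝ) : Prop :=
  ∃ f : E → ℝ, IsDensity μ ν f ∧ Integrable (fun x => Real.negMulLog (f x)) μ ∧
    h * Real.log 2 = ∫ x, Real.negMulLog (f x) ∂μ

namespace IsDensity

variable {E F : Type*} [MeasurableSpace E] [MeasurableSpace F]

theorem lintegral_eq_one {μ ν : Measure E} [IsProbabilityMeasure ν] {f : E → ℝ}
    (hf : IsDensity μ ν f) : ∫⁻ x, ENNReal.ofReal (f x) ∂μ = 1 := by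
  have h : ν Set.univ = 1 := measure_univ
  rwa [hf.2.2, withDensity_apply _ MeasurableSet.univ, Measure.restrict_univ] at h

theorem integrable {μ ν : Measure E} [IsProbabilityMeasure ν] {f : E → ℝ}
    (hf : IsDensity μ ν f) : Integrable f μ := by
  refine ⟨hf.1.aestronglyMeasurable, ?_⟩
  rw [hasFiniteIntegral_iff_ofReal (Filter.Eventually.of_forall hf.2.1), hf.lintegral_eq_one]
  exact ENNReal.one_lt_top

theorem integral_eq_one {μ ν : Measure E} [IsProbabilityMeasure ν] {f : E → ℝ}
    (hf : IsDensity μ ν f) : ∫ x, f x ∂μ = 1 := by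
  rw [integral_eq_lintegral_of_nonneg_ae (Filter.Eventually.of_forall hf.2.1)
    hf.1.aestronglyMeasurable, hf.lintegral_eq_one, ENNReal.toReal_one]

theorem prod {μ ν : Measure E} {μ' ν' : Measure F} [SigmaFinite μ] [SigmaFinite μ']
    {f : E → ℝ} {f' : F → ℝ} (hf : IsDensity μ ν f) (hf' : IsDensity μ' ν' f') :
    IsDensity (μ.prod μ') (ν.prod ν') fun z => f z.1 * f' z.2 := by
  have hm := hf.1
  have hm' := hf'.1
  refine ⟨by fun_prop, fun z => mul_nonneg (hf.2.1 _) (hf'.2.1 _), ?_⟩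
  rw [hf.2.2, hf'.2.2, prod_withDensity (by fun_prop) (by fun_prop)]
  congr 1
  ext z
  rw [ENNReal.ofReal_mul (hf.2.1 _)]

theorem map {μ ν : Measure E} {μ' : Measure F} {f : E → ℝ} (hf : IsDensity μ ν f)
    (e : E ≃ᵐ F) (he : MeasurePreserving e μ μ') :
    IsDensity μ' (ν.map e) (f ∘ e.symm) := by
  refine ⟨hf.1.comp e.symm.measurable, fun x => hf.2.1 _, ?_⟩
  ext s hs
  rw [e.map_apply, hf.2.2, withDensity_apply _ (e.measurable hs), withDensity_apply _ hs,
    ← he.setLIntegral_comp_preimage_emb e.measurableEmbedding]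
  simp

theorem mixture {μ ν ν' : Measure E} {f f' : E → ℝ} (hf : IsDensity μ ν f)
    (hf' : IsDensity μ ν' f') {p q : ℝ} (hp : 0 ≤ p) (hq : 0 ≤ q) :
    IsDensity μ (ENNReal.ofReal p • ν + ENNReal.ofReal q • ν')
      fun x => p * f x + q * f' x := by
  have hm := hf.1
  have hm' := hf'.1
  refine ⟨by fun_prop, fun x => add_nonneg (mul_nonneg hp (hf.2.1 _))
    (mul_nonneg hq (hf'.2.1 _)), ?_⟩
  rw [hf.2.2, hf'.2.2, ← withDensity_smul _ (by fun_prop), ← withDensity_smul _ (by fun_prop),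
    ← withDensity_add_left (by fun_prop)]
  congr 1
  ext x
  simp only [Pi.add_apply, Pi.smul_apply, smul_eq_mul]
  rw [ENNReal.ofReal_add (mul_nonneg hp (hf.2.1 _)) (mul_nonneg hq (hf'.2.1 _)),
    ENNReal.ofReal_mul hp, ENNReal.ofReal_mul hq]

end IsDensity

theorem negMulLog_add_le {x y : ℝ} (hx : 0 ≤ x) (hy : 0 ≤ y) :
    Real.negMulLog (x + y) ≤ Real.negMulLog x + Real.negMulLog y := by
  have key : ∀ {a b : ℝ}, 0 ≤ a → 0 ≤ b → a * Real.log a ≤ a * Real.log (a + b) := by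
    intro a b ha hb
    rcases ha.eq_or_lt with rfl | ha
    · simp
    · exact mul_le_mul_of_nonneg_left (Real.log_le_log ha (by linarith)) ha.le
  have h1 := key hx hy
  have h2 := key hy hx
  rw [add_comm y x] at h2
  simp only [Real.negMulLog]
  linarith

namespace HasDiffEntropy

variable {E F : Type*} [MeasurableSpace E] [MeasurableSpace F]

theorem prod {μ ν : Measure E} {μ' ν' : Measure F} [SigmaFinite μ] [SigmaFinite μ']
    [IsProbabilityMeasure ν] [IsProbabilityMeasure ν'] {h h' : ℝ}
    (hν : HasDiffEntropy μ ν h) (hν' : HasDiffEntropy μ' ν' h') :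
    HasDiffEntropy (μ.prod μ') (ν.prod ν') (h + h') := by
  obtain ⟨f, hf, hi, hh⟩ := hν
  obtain ⟨f', hf', hi', hh'⟩ := hν'
  have hi₁ := hi.mul_prod hf'.integrable
  have hi₂ := hf.integrable.mul_prod hi'
  have heq : (fun z : E × F => Real.negMulLog (f z.1 * f' z.2)) = fun z =>
      Real.negMulLog (f z.1) * f' z.2 + f z.1 * Real.negMulLog (f' z.2) := by
    ext z
    rw [Real.negMulLog_mul]
    ring
  refine ⟨_, hf.prod hf', ?_, ?_⟩
  · rw [heq]
    exact hi₁.add hi₂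
  · rw [heq, integral_add hi₁ hi₂, integral_prod_mul (fun x => Real.negMulLog (f x)) f',
      integral_prod_mul f fun y => Real.negMulLog (f' y), hf.integral_eq_one,
      hf'.integral_eq_one, ← hh, ← hh']
    ring

theorem map {μ ν : Measure E} {μ' : Measure F} {h : ℝ} (hν : HasDiffEntropy μ ν h)
    (e : E ≃ᵐ F) (he : MeasurePreserving e μ μ') : HasDiffEntropy μ' (ν.map e) h := by
  obtain ⟨f, hf, hi, hh⟩ := hν
  refine ⟨_, hf.map e he, ?_, ?_⟩
  · rw [← he.integrable_comp_emb e.measurableEmbedding]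
    simpa [Function.comp_def] using hi
  · rw [hh, ← he.integral_comp e.measurableEmbedding]
    simp

theorem mixture {μ ν ν' : Measure E} [IsProbabilityMeasure ν] [IsProbabilityMeasure ν']
    {h h' : ℝ} (hν : HasDiffEntropy μ ν h) (hν' : HasDiffEntropy μ ν' h') {p q : ℝ}
    (hp : 0 ≤ p) (hq : 0 ≤ q) (hpq : p + q = 1) :
    ∃ h'', HasDiffEntropy μ (ENNReal.ofReal p • ν + ENNReal.ofReal q • ν') h'' ∧
      p * h + q * h' ≤ h'' ∧
      h'' ≤ p * h + q * h' + (Real.negMulLog p + Real.negMulLog q) / Real.log 2 := by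
  obtain ⟨f, hf, hi, hh⟩ := hν
  obtain ⟨f', hf', hi', hh'⟩ := hν'
  set L : E → ℝ := fun x => p * Real.negMulLog (f x) + q * Real.negMulLog (f' x) with hL
  set U : E → ℝ := fun x => L x + (Real.negMulLog p * f x + Real.negMulLog q * f' x) with hU
  set m : E → ℝ := fun x => Real.negMulLog (p * f x + q * f' x) with hm
  have hLm : ∀ x, L x ≤ m x := fun x =>
    Real.concaveOn_negMulLog.2 (Set.mem_Ici.2 (hf.2.1 x)) (Set.mem_Ici.2 (hf'.2.1 x)) hp hq hpq
  have hmU : ∀ x, m x ≤ U x := by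
    intro x
    have h1 := negMulLog_add_le (mul_nonneg hp (hf.2.1 x)) (mul_nonneg hq (hf'.2.1 x))
    rw [Real.negMulLog_mul, Real.negMulLog_mul] at h1
    simp only [hm, hU, hL]
    linarith
  have iL : Integrable L μ := (hi.const_mul p).add (hi'.const_mul q)
  have iD : Integrable (fun x => Real.negMulLog p * f x + Real.negMulLog q * f' x) μ :=
    (hf.integrable.const_mul _).add (hf'.integrable.const_mul _)
  have iU : Integrable U μ := iL.add iD
  have im : Integrable m μ := by
    have hmeas := hf.1
    have hmeas' := hf'.1
    exact integrable_of_le_of_le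
      (Real.continuous_negMulLog.measurable.comp (by fun_prop)).aestronglyMeasurable
      (Filter.Eventually.of_forall hLm) (Filter.Eventually.of_forall hmU) iL iU
  have eL : ∫ x, L x ∂μ = (p * h + q * h') * Real.log 2 := by
    rw [hL, integral_add (hi.const_mul p) (hi'.const_mul q), integral_const_mul,
      integral_const_mul, ← hh, ← hh']
    ring
  have eU : ∫ x, U x ∂μ =
      (p * h + q * h') * Real.log 2 + (Real.negMulLog p + Real.negMulLog q) := by
    rw [hU, integral_add iL iD, eL, integral_add (hf.integrable.const_mul _)
      (hf'.integrable.const_mul _), integral_const_mul, integral_const_mul,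
      hf.integral_eq_one, hf'.integral_eq_one]
    ring
  have h2 : 0 < Real.log 2 := Real.log_pos one_lt_two
  have lower := integral_mono iL im hLm
  have upper := integral_mono im iU hmU
  rw [eL] at lower
  rw [eU] at upper
  refine ⟨(∫ x, m x ∂μ) / Real.log 2, ⟨_, hf.mixture hf' hp hq, im, ?_⟩, ?_, ?_⟩
  · rw [div_mul_cancel₀ _ h2.ne']
  · rwa [le_div_iff₀ h2]
  · rwa [div_le_iff₀ h2, add_mul, div_mul_cancel₀ _ h2.ne']

/-- The entropy of an indicator density is zero. -/
theorem of_restrict {μ : Measure E} {s : Set E} (hs : MeasurableSet s) :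
    HasDiffEntropy μ (μ.restrict s) 0 := by
  have h0 : (fun x => Real.negMulLog (s.indicator (fun _ => (1 : ℝ)) x)) = fun _ => 0 := by
    ext x
    by_cases hx : x ∈ s <;> simp [hx]
  refine ⟨s.indicator fun _ => 1, ⟨measurable_const.indicator hs,
    Set.indicator_nonneg fun _ _ => zero_le_one, ?_⟩, ?_, ?_⟩
  · rw [← withDensity_indicator_one hs]
    congr 1
    ext x
    by_cases hx : x ∈ s <;> simp [hx]
  · rw [h0]
    exact integrable_zero _ _ _
  · rw [h0]
    simp

end HasDiffEntropy

theorem mul_logb_two_eq (x : ℝ) : x * Real.logb 2 x = -(Real.negMulLog x / Real.log 2) := by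
  rw [Real.logb, Real.negMulLog]
  ring

theorem hasDiffEntropy_iff {E : Type*} [MeasurableSpace E] {μ ν : Measure E} {h : ℝ} :
    HasDiffEntropy μ ν h ↔ ∃ f : E → ℝ, Measurable f ∧ (∀ x, 0 ≤ f x) ∧
      ν = μ.withDensity (fun x => ENNReal.ofReal (f x)) ∧
      Integrable (fun x => f x * Real.logb 2 (f x)) μ ∧
      h = -∫ x, f x * Real.logb 2 (f x) ∂μ := by
  have h2 : Real.log 2 ≠ 0 := (Real.log_pos one_lt_two).ne'
  simp only [HasDiffEntropy, IsDensity, mul_logb_two_eq, and_assoc]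
  refine exists_congr fun f => and_congr_right' <| and_congr_right' <| and_congr_right' <|
    and_congr ?_ ?_
  · refine ⟨fun hi => (hi.div_const _).neg, fun hi => ?_⟩
    convert! hi.neg.mul_const (Real.log 2) using 2 with x
    simp [h2]
  · rw [integral_neg, integral_div, neg_neg, eq_div_iff h2]

/-- `P` is a joint law of `n` random vectors of lengths `k i` with entropy function `g`. -/
def IsEntropyLaw {n : ℕ} (k : Fin n → ℕ) (P : Measure ((i : Fin n) → Fin (k i) → ℝ))
    (g : Finset (Fin n) → ℝ) : Prop :=
  IsProbabilityMeasure P ∧ (∃ f, IsDensity volume P f) ∧ g ∅ = 0 ∧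
    ∀ α : Finset (Fin n), α.Nonempty → HasDiffEntropy volume (P.map α.restrict) (g α)

theorem isVEntropic_iff_s15 {n : ℕ} {g : Finset (Fin n) → ℝ} :
    IsVEntropic n g ↔ ∃ k : Fin n → ℕ, (∀ i, 0 < k i) ∧ ∃ P, IsEntropyLaw k P g := by
  refine exists_congr fun k => and_congr_right' ⟨?_, ?_⟩
  · rintro ⟨Ω, _, X, hΩ, hX, hf, h0, hα⟩
    refine ⟨Measure.map (fun ω i => X i ω) volume, Measure.isProbabilityMeasure_map
      hX.aemeasurable, hf, h0, fun α hne => ?_⟩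
    rw [Measure.map_map (Finset.measurable_restrict α) hX]
    exact hasDiffEntropy_iff.2 (hα α hne)
  · rintro ⟨P, hP, ⟨f, hf⟩, h0, hα⟩
    exact ⟨(i : Fin n) → Fin (k i) → ℝ, ⟨P⟩, fun i ω => ω i, hP, measurable_id,
      ⟨f, hf.1, hf.2.1, Measure.map_id.trans hf.2.2⟩, h0,
      fun α hne => hasDiffEntropy_iff.1 (hα α hne)⟩

/-- Blockwise concatenation of two families of vectors. -/
def concatEquiv {ι : Type*} (k l : ι → ℕ) :
    (((i : ι) → Fin (k i) → ℝ) × ((i : ι) → Fin (l i) → ℝ)) ≃ᵐ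
      ((i : ι) → Fin (k i + l i) → ℝ) where
  toFun z i := Fin.append (z.1 i) (z.2 i)
  invFun x := (fun i j => x i (Fin.castAdd _ j), fun i j => x i (Fin.natAdd _ j))
  left_inv z := by simp
  right_inv x := by
    ext i j
    refine Fin.addCases (fun j => ?_) (fun j => ?_) j <;> simp
  measurable_toFun := by
    refine measurable_pi_lambda _ fun i => measurable_pi_lambda _ fun j => ?_
    refine Fin.addCases (fun j => ?_) (fun j => ?_) j
    · simp only [Equiv.coe_fn_mk, Fin.append_left]
      fun_prop
    · simp only [Equiv.coe_fn_mk, Fin.append_right]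
      fun_prop
  measurable_invFun := by
    simp only [Equiv.coe_fn_symm_mk]
    fun_prop

theorem measurePreserving_concatEquiv {ι : Type*} [Fintype ι] (k l : ι → ℕ) :
    MeasurePreserving (concatEquiv k l) (volume.prod volume) volume := by
  refine ⟨(concatEquiv k l).measurable, Eq.symm ?_⟩
  refine Measure.pi_eq_generateFrom (fun i => generateFrom_pi) (fun i => isPiSystem_pi)
    (fun i => Measure.FiniteSpanningSetsIn.pi fun _ => volume.toFiniteSpanningSetsIn) ?_
  intro s hs
  choose t ht hst using hs
  obtain rfl : (fun i => Set.univ.pi (t i)) = s := funext hst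
  have hpre : concatEquiv k l ⁻¹' (Set.univ.pi fun i => Set.univ.pi (t i)) =
      (Set.univ.pi fun i => Set.univ.pi fun j => t i (Fin.castAdd _ j)) ×ˢ
        (Set.univ.pi fun i => Set.univ.pi fun j => t i (Fin.natAdd _ j)) := by
    ext z
    simp only [concatEquiv, MeasurableEquiv.coe_mk, Equiv.coe_fn_mk, Set.mem_preimage,
      Set.mem_univ_pi, Set.mem_prod, Fin.forall_fin_add, Fin.append_left, Fin.append_right,
      forall_and]
  rw [MeasurableEquiv.map_apply, hpre, Measure.prod_prod]
  simp only [volume_pi, Measure.pi_pi, Fin.prod_univ_add, Finset.prod_mul_distrib]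

theorem IsEntropyLaw.concat {n : ℕ} {k l : Fin n → ℕ}
    {P : Measure ((i : Fin n) → Fin (k i) → ℝ)} {Q : Measure ((i : Fin n) → Fin (l i) → ℝ)}
    {a b : Finset (Fin n) → ℝ} (hP : IsEntropyLaw k P a) (hQ : IsEntropyLaw l Q b) :
    IsEntropyLaw (fun i => k i + l i) ((P.prod Q).map (concatEquiv k l)) (a + b) := by
  obtain ⟨hp, ⟨f, hf⟩, ha0, ha⟩ := hP
  obtain ⟨hq, ⟨f', hf'⟩, hb0, hb⟩ := hQ
  refine ⟨Measure.isProbabilityMeasure_map (concatEquiv k l).measurable.aemeasurable,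
    ⟨_, (hf.prod hf').map _ (measurePreserving_concatEquiv k l)⟩, by simp [ha0, hb0],
    fun α hα => ?_⟩
  have hPα : Measurable (α.restrict (π := fun i => Fin (k i) → ℝ)) := Finset.measurable_restrict α
  have hQα : Measurable (α.restrict (π := fun i => Fin (l i) → ℝ)) := Finset.measurable_restrict α
  have := Measure.isProbabilityMeasure_map (μ := P) hPα.aemeasurable
  have := Measure.isProbabilityMeasure_map (μ := Q) hQα.aemeasurable
  have key := ((ha α hα).prod (hb α hα)).map
    (concatEquiv (fun i : α => k i) (fun i : α => l i)) (measurePreserving_concatEquiv _ _)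
  rw [Measure.map_prod_map _ _ hPα hQα, Measure.map_map (MeasurableEquiv.measurable _)
    (hPα.prodMap hQα)] at key
  rw [Measure.map_map (Finset.measurable_restrict α) (MeasurableEquiv.measurable _)]
  exact key

theorem IsEntropyLaw.mixture {n : ℕ} {k : Fin n → ℕ}
    {P Q : Measure ((i : Fin n) → Fin (k i) → ℝ)} {a b : Finset (Fin n) → ℝ}
    (hP : IsEntropyLaw k P a) (hQ : IsEntropyLaw k Q b) {p q : ℝ}
    (hp : 0 ≤ p) (hq : 0 ≤ q) (hpq : p + q = 1) :
    ∃ g, IsEntropyLaw k (ENNReal.ofReal p • P + ENNReal.ofReal q • Q) g ∧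
      ∀ α, p * a α + q * b α ≤ g α ∧
        g α ≤ p * a α + q * b α + (Real.negMulLog p + Real.negMulLog q) / Real.log 2 := by
  obtain ⟨hP1, ⟨f, hf⟩, ha0, ha⟩ := hP
  obtain ⟨hQ1, ⟨f', hf'⟩, hb0, hb⟩ := hQ
  have hH : 0 ≤ (Real.negMulLog p + Real.negMulLog q) / Real.log 2 :=
    div_nonneg (add_nonneg (Real.negMulLog_nonneg hp (by linarith))
      (Real.negMulLog_nonneg hq (by linarith))) (Real.log_pos one_lt_two).le
  have key : ∀ α : Finset (Fin n), ∃ h, (α = ∅ → h = 0) ∧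
      (α.Nonempty → HasDiffEntropy volume
        ((ENNReal.ofReal p • P + ENNReal.ofReal q • Q).map α.restrict) h) ∧
      p * a α + q * b α ≤ h ∧
        h ≤ p * a α + q * b α + (Real.negMulLog p + Real.negMulLog q) / Real.log 2 := by
    intro α
    rcases α.eq_empty_or_nonempty with rfl | hα
    · exact ⟨0, by simp, by simp, by simp [ha0, hb0], by simpa [ha0, hb0] using hH⟩
    · have hm : Measurable (α.restrict (π := fun i => Fin (k i) → ℝ)) :=
        Finset.measurable_restrict α
      have := Measure.isProbabilityMeasure_map (μ := P) hm.aemeasurable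
      have := Measure.isProbabilityMeasure_map (μ := Q) hm.aemeasurable
      obtain ⟨h, hh, hb⟩ := (ha α hα).mixture (hb α hα) hp hq hpq
      refine ⟨h, fun h0 => absurd h0 hα.ne_empty, fun _ => ?_, hb⟩
      rwa [Measure.map_add _ _ hm, Measure.map_smul, Measure.map_smul]
  choose g hg0 hg hb using key
  refine ⟨g, ⟨⟨?_⟩, ⟨_, hf.mixture hf' hp hq⟩, hg0 ∅ rfl, hg⟩, hb⟩
  simp [← ENNReal.ofReal_add hp hq, hpq]

theorem exists_isEntropyLaw_zero {n : ℕ} (k : Fin n → ℕ) : ∃ P, IsEntropyLaw k P 0 := by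
  let s {ι : Type} (k : ι → ℕ) : Set ((i : ι) → Fin (k i) → ℝ) :=
    Set.univ.pi fun i => Set.univ.pi fun _ => Set.Icc 0 1
  have hs {ι : Type} [Fintype ι] (k : ι → ℕ) : MeasurableSet (s k) :=
    MeasurableSet.univ_pi fun i => MeasurableSet.univ_pi fun _ => measurableSet_Icc
  let u (d : ℕ) : Measure (Fin d → ℝ) := volume.restrict (Set.univ.pi fun _ => Set.Icc 0 1)
  have hu (d : ℕ) : IsProbabilityMeasure (u d) := ⟨by
    rw [Measure.restrict_apply_univ, volume_pi_pi]
    simp⟩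
  have hr {ι : Type} [Fintype ι] (k : ι → ℕ) :
      Measure.pi (fun i => u (k i)) = volume.restrict (s k) :=
    (Measure.restrict_pi_pi _ _).symm
  refine ⟨Measure.pi fun i => u (k i), inferInstance, ?_, rfl, fun α _ => ?_⟩
  · rw [hr]
    obtain ⟨f, hf, -⟩ := HasDiffEntropy.of_restrict (μ := volume) (hs k)
    exact ⟨f, hf⟩
  · rw [← Measure.infinitePi_eq_pi, Measure.infinitePi_map_restrict, hr]
    exact HasDiffEntropy.of_restrict (hs _)

theorem IsVEntropic.add_s15 {n : ℕ} {a b : Finset (Fin n) → ℝ} (ha : IsVEntropic n a)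
    (hb : IsVEntropic n b) : IsVEntropic n (a + b) := by
  obtain ⟨k, hk, P, hP⟩ := isVEntropic_iff_s15.1 ha
  obtain ⟨l, -, Q, hQ⟩ := isVEntropic_iff_s15.1 hb
  exact isVEntropic_iff_s15.2 ⟨_, fun i => Nat.add_pos_left (hk i) _, _, hP.concat hQ⟩

theorem IsVEntropic.natCast_succ_smul {n : ℕ} {a : Finset (Fin n) → ℝ} (ha : IsVEntropic n a)
    (M : ℕ) : IsVEntropic n (((M + 1 : ℕ) : ℝ) • a) := by
  induction M with
  | zero => simpa using ha
  | succ M ih =>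
    rw [Nat.cast_succ, add_smul, one_smul]
    exact ih.add_s15 ha

theorem IsVEntropic.exists_near_smul {n : ℕ} {a : Finset (Fin n) → ℝ} (ha : IsVEntropic n a)
    {q : ℝ} (hq : 0 ≤ q) (hq1 : q ≤ 1) :
    ∃ g, IsVEntropic n g ∧ ∀ α, q * a α ≤ g α ∧
      g α ≤ q * a α + (Real.negMulLog (1 - q) + Real.negMulLog q) / Real.log 2 := by
  obtain ⟨k, hk, P, hP⟩ := isVEntropic_iff_s15.1 ha
  obtain ⟨Q, hQ⟩ := exists_isEntropyLaw_zero k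
  obtain ⟨g, hg, hb⟩ := hQ.mixture hP (sub_nonneg.2 hq1) hq (sub_add_cancel 1 q)
  exact ⟨g, isVEntropic_iff_s15.2 ⟨k, hk, _, hg⟩, by simpa using hb⟩

/-- Mixing `M` independent copies, taken with probability `c / M`, with a law of zero entropy
approximates `c • a` as `M` grows. -/
theorem IsVEntropic.smul_mem_closure {n : ℕ} {a : Finset (Fin n) → ℝ} (ha : IsVEntropic n a)
    {c : ℝ} (hc : 0 ≤ c) : c • a ∈ closure {g : Finset (Fin n) → ℝ | IsVEntropic n g} := by
  have hlim : Filter.Tendsto (fun M : ℕ => c / ((M + 1 : ℕ) : ℝ)) Filter.atTop (nhds 0) :=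
    (tendsto_const_div_atTop_nhds_zero_nat c).comp (Filter.tendsto_add_atTop_nat 1)
  have hle : ∀ᶠ M : ℕ in Filter.atTop, c / ((M + 1 : ℕ) : ℝ) ≤ 1 :=
    hlim.eventually (Iic_mem_nhds zero_lt_one)
  have hex : ∀ M : ℕ, ∃ g, c / ((M + 1 : ℕ) : ℝ) ≤ 1 → IsVEntropic n g ∧
      ∀ α, c * a α ≤ g α ∧ g α ≤ c * a α +
        (Real.negMulLog (1 - c / ((M + 1 : ℕ) : ℝ)) +
          Real.negMulLog (c / ((M + 1 : ℕ) : ℝ))) / Real.log 2 := by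
    intro M
    by_cases h : c / ((M + 1 : ℕ) : ℝ) ≤ 1
    · obtain ⟨g, hg, hb⟩ := (ha.natCast_succ_smul M).exists_near_smul (by positivity) h
      have hM : ((M + 1 : ℕ) : ℝ) ≠ 0 := by positivity
      simp only [Pi.smul_apply, smul_eq_mul, ← mul_assoc, div_mul_cancel₀ _ hM] at hb
      exact ⟨g, fun _ => ⟨hg, hb⟩⟩
    · exact ⟨0, fun h' => absurd h' h⟩
  choose g hg using hex
  have hH : Filter.Tendsto (fun M : ℕ => (Real.negMulLog (1 - c / ((M + 1 : ℕ) : ℝ)) +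
      Real.negMulLog (c / ((M + 1 : ℕ) : ℝ))) / Real.log 2) Filter.atTop (nhds 0) := by
    have hcont : Continuous fun q : ℝ =>
        (Real.negMulLog (1 - q) + Real.negMulLog q) / Real.log 2 := by fun_prop
    simpa [Function.comp_def] using (hcont.tendsto 0).comp hlim
  refine mem_closure_of_tendsto (b := Filter.atTop) (f := g) (tendsto_pi_nhds.2 fun α => ?_)
    (hle.mono fun M hM => (hg M hM).1)
  exact tendsto_of_tendsto_of_tendsto_of_le_of_le' tendsto_const_nhds
    (by simpa using hH.const_add (c * a α))
    (hle.mono fun M hM => ((hg M hM).2 α).1) (hle.mono fun M hM => ((hg M hM).2 α).2)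

/-- `closure(γ*_{v,n})` is a closed convex cone: it is closed under
addition and under multiplication by nonnegative real scalars. -/
theorem stmt15 (n : ℕ) :
    IsClosed (closure {g : Finset (Fin n) → ℝ | IsVEntropic n g}) ∧
    (∀ a ∈ closure {g : Finset (Fin n) → ℝ | IsVEntropic n g},
      ∀ b ∈ closure {g : Finset (Fin n) → ℝ | IsVEntropic n g},
        a + b ∈ closure {g : Finset (Fin n) → ℝ | IsVEntropic n g}) ∧
    (∀ c : ℝ, 0 ≤ c →
      ∀ a ∈ closure {g : Finset (Fin n) → ℝ | IsVEntropic n g},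
        c • a ∈ closure {g : Finset (Fin n) → ℝ | IsVEntropic n g}) := by
  refine ⟨isClosed_closure, fun a ha b hb => ?_, fun c hc a ha => ?_⟩
  · exact map_mem_closure₂ continuous_add ha hb fun x hx y hy => IsVEntropic.add_s15 hx hy
  · exact closure_minimal (fun x hx => IsVEntropic.smul_mem_closure hx hc)
      (isClosed_closure.preimage (continuous_const_smul c)) ha

end
end

section
/- Let X_1,…,X_n be finitely-valued discrete random variables with Shannon entropy function g, i.e. g(α) = H(X_α) for all α ⊆ N. For any positive reals c_1,…,c_n, the rank function g* defined by g*(α) = g(α) − ∑_{i∈α} log c_i is s-entropic: there exist real-valued random variables Y_1,…,Y_n whose joint law has a density such that for every nonempty α ⊆ N the differential entropy of (Y_i)_{i∈α} equals g*(α). -/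
open MeasureTheory

noncomputable section

/-- The uniform distribution on the interval of length `1 / c` starting at `a / c`. -/
def cellMeasure (c : ℝ) (a : ℕ) : Measure ℝ :=
  ENNReal.ofReal c • volume.restrict (Set.Ico (a / c) ((a + 1) / c))

lemma isProbabilityMeasure_cellMeasure {c : ℝ} (hc : 0 < c) (a : ℕ) :
    IsProbabilityMeasure (cellMeasure c a) := by
  constructor
  simp only [cellMeasure, Measure.smul_apply, Measure.restrict_apply_univ, Real.volume_Ico,
    smul_eq_mul]
  rw [← ENNReal.ofReal_mul hc.le, ← ENNReal.ofReal_one]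
  congr 1
  field_simp
  ring

section Cells

variable {ι : Type*}

/-- The box `∏ i, [x i / c i, (x i + 1) / c i)`. -/
def cell {S : ι → ℕ} (c : ι → ℝ) (x : (i : ι) → Fin (S i)) : Set (ι → ℝ) :=
  Set.univ.pi fun i => Set.Ico ((x i : ℕ) / c i) (((x i : ℕ) + 1) / c i)

variable {S : ι → ℕ} {c : ι → ℝ}

lemma eq_of_mem_cell (hc : ∀ i, 0 < c i) {x x' : (i : ι) → Fin (S i)} {y : ι → ℝ}
    (hx : y ∈ cell c x) (hx' : y ∈ cell c x') : x = x' := by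
  funext i
  obtain ⟨h₁, h₂⟩ := hx i (Set.mem_univ i)
  obtain ⟨h₃, h₄⟩ := hx' i (Set.mem_univ i)
  have h₅ := h₁.trans_lt h₄
  have h₆ := h₃.trans_lt h₂
  rw [div_lt_div_iff_of_pos_right (hc i)] at h₅ h₆
  norm_cast at h₅ h₆
  exact Fin.ext (by omega)

variable [Fintype ι]

lemma measurableSet_cell (x : (i : ι) → Fin (S i)) : MeasurableSet (cell c x) :=
  MeasurableSet.univ_pi fun _ => measurableSet_Ico

lemma volume_cell (hc : ∀ i, 0 < c i) (x : (i : ι) → Fin (S i)) :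
    volume (cell c x) = ENNReal.ofReal (∏ i, c i)⁻¹ := by
  rw [cell, volume_pi_pi, ← Finset.prod_inv_distrib,
    ENNReal.ofReal_prod_of_nonneg fun i _ => (inv_pos.2 (hc i)).le]
  refine Finset.prod_congr rfl fun i _ => ?_
  rw [Real.volume_Ico]
  congr 1
  have := (hc i).ne'
  field_simp
  ring

lemma integrable_indicator_cell (hc : ∀ i, 0 < c i) (x : (i : ι) → Fin (S i)) (r : ℝ) :
    Integrable ((cell c x).indicator fun _ => r) :=
  (integrable_indicator_iff (measurableSet_cell x)).2 <|
    integrableOn_const (by rw [volume_cell hc]; exact ENNReal.ofReal_ne_top)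

lemma pi_cellMeasure (hc : ∀ i, 0 < c i) (x : (i : ι) → Fin (S i)) :
    Measure.pi (fun i => cellMeasure (c i) (x i)) =
      ENNReal.ofReal (∏ i, c i) • volume.restrict (cell c x) := by
  have := fun i => isProbabilityMeasure_cellMeasure (hc i) (x i)
  refine Measure.pi_eq fun s _ => ?_
  rw [cell, volume_pi, Measure.restrict_pi_pi, Measure.smul_apply, Measure.pi_pi, smul_eq_mul,
    ENNReal.ofReal_prod_of_nonneg fun i _ => (hc i).le, ← Finset.prod_mul_distrib]
  rfl

variable [DecidableEq ι]

/-- The density which gives mass `q x` to the box `cell c x` and is constant on each box. -/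
def cellDensity (c : ι → ℝ) (q : ((i : ι) → Fin (S i)) → ℝ) (y : ι → ℝ) : ℝ :=
  ∑ x, (cell c x).indicator (fun _ => q x * ∏ i, c i) y

/-- The mixture of the uniform distributions on the boxes `cell c x` with weights `q x`. -/
def cellMixture (c : ι → ℝ) (q : ((i : ι) → Fin (S i)) → ℝ) : Measure (ι → ℝ) :=
  ∑ x, ENNReal.ofReal (q x) • Measure.pi fun i => cellMeasure (c i) (x i)

variable {q : ((i : ι) → Fin (S i)) → ℝ}

lemma apply_cellDensity (hc : ∀ i, 0 < c i) {φ : ℝ → ℝ} (hφ : φ 0 = 0) (y : ι → ℝ) :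
    φ (cellDensity c q y) =
      ∑ x, (cell c x).indicator (fun _ => φ (q x * ∏ i, c i)) y := by
  by_cases h : ∃ x : (i : ι) → Fin (S i), y ∈ cell c x
  · obtain ⟨x, hx⟩ := h
    have h_out (x' : (i : ι) → Fin (S i)) (hne : x' ≠ x) : y ∉ cell c x' :=
      fun h' => hne (eq_of_mem_cell hc h' hx)
    rw [cellDensity, Fintype.sum_eq_single x fun x' hx' => Set.indicator_of_notMem (h_out x' hx') _,
      Fintype.sum_eq_single x fun x' hx' => Set.indicator_of_notMem (h_out x' hx') _,
      Set.indicator_of_mem hx, Set.indicator_of_mem hx]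
  · push Not at h
    simp [cellDensity, h, hφ]

lemma measurable_cellDensity : Measurable (cellDensity c q) :=
  Finset.measurable_sum _ fun x _ => measurable_const.indicator (measurableSet_cell x)

lemma cellDensity_nonneg (hc : ∀ i, 0 < c i) (hq : ∀ x, 0 ≤ q x) (y : ι → ℝ) :
    0 ≤ cellDensity c q y :=
  Finset.sum_nonneg fun x _ => Set.indicator_nonneg
    (fun _ _ => mul_nonneg (hq x) (Finset.prod_nonneg fun i _ => (hc i).le)) y

lemma cellMixture_eq_withDensity (hc : ∀ i, 0 < c i) (hq : ∀ x, 0 ≤ q x) :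
    cellMixture c q = volume.withDensity fun y => ENNReal.ofReal (cellDensity c q y) := by
  have h_prod : 0 ≤ ∏ i, c i := Finset.prod_nonneg fun i _ => (hc i).le
  ext s hs
  have h_density (y : ι → ℝ) : ENNReal.ofReal (cellDensity c q y) =
      ∑ x, (cell c x).indicator (fun _ => ENNReal.ofReal (q x * ∏ i, c i)) y := by
    rw [cellDensity, ENNReal.ofReal_sum_of_nonneg fun x _ => Set.indicator_nonneg
      (fun _ _ => mul_nonneg (hq x) h_prod) y]
    refine Finset.sum_congr rfl fun x _ => ?_
    by_cases h : y ∈ cell c x <;> simp [h]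
  simp_rw [withDensity_apply _ hs, h_density]
  rw [lintegral_finsetSum _ fun x _ => measurable_const.indicator (measurableSet_cell x),
    cellMixture, Measure.finsetSum_apply]
  refine Finset.sum_congr rfl fun x _ => ?_
  rw [lintegral_indicator_const (measurableSet_cell x), pi_cellMeasure hc,
    Measure.smul_apply, Measure.smul_apply, Measure.restrict_apply hs,
    Measure.restrict_apply (measurableSet_cell x), ENNReal.ofReal_mul (hq x), Set.inter_comm,
    smul_eq_mul, smul_eq_mul, mul_assoc]

lemma isProbabilityMeasure_cellMixture (hc : ∀ i, 0 < c i) (hq : ∀ x, 0 ≤ q x)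
    (hq_sum : ∑ x, q x = 1) : IsProbabilityMeasure (cellMixture c q) := by
  have := fun (x : (i : ι) → Fin (S i)) i => isProbabilityMeasure_cellMeasure (hc i) (x i)
  constructor
  simp only [cellMixture, Measure.finsetSum_apply, Measure.smul_apply, measure_univ,
    smul_eq_mul, mul_one]
  rw [← ENNReal.ofReal_sum_of_nonneg fun x _ => hq x, hq_sum, ENNReal.ofReal_one]

lemma integrable_cellDensity_mul_logb (hc : ∀ i, 0 < c i) :
    Integrable fun y => cellDensity c q y * Real.logb 2 (cellDensity c q y) := by
  simp_rw [apply_cellDensity (q := q) hc (φ := fun t => t * Real.logb 2 t) (zero_mul _)]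
  exact integrable_finsetSum _ fun x _ => integrable_indicator_cell hc x _

lemma integral_cellDensity_mul_logb (hc : ∀ i, 0 < c i) :
    ∫ y, cellDensity c q y * Real.logb 2 (cellDensity c q y) =
      ∑ x, q x * Real.logb 2 (q x) + (∑ x, q x) * ∑ i, Real.logb 2 (c i) := by
  have h_prod : 0 < ∏ i, c i := Finset.prod_pos fun i _ => hc i
  simp_rw [apply_cellDensity (q := q) hc (φ := fun t => t * Real.logb 2 t) (zero_mul _)]
  rw [integral_finsetSum _ fun x _ => integrable_indicator_cell hc x _, Finset.sum_mul,
    ← Finset.sum_add_distrib]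
  refine Finset.sum_congr rfl fun x _ => ?_
  rw [integral_indicator_const _ (measurableSet_cell x), measureReal_def, volume_cell hc,
    ENNReal.toReal_ofReal (inv_pos.2 h_prod).le, smul_eq_mul]
  rcases eq_or_ne (q x) 0 with h | h
  · simp [h]
  · rw [Real.logb_mul h h_prod.ne', Real.logb_prod _ _ fun i _ => (hc i).ne']
    field_simp

end Cells

section Marginal

variable {n : ℕ} {S : Fin n → ℕ} {p : ((i : Fin n) → Fin (S i)) → ℝ}

lemma marginalPMF_nonneg (hp : ∀ x, 0 ≤ p x) (α : Finset (Fin n))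
    (x : (i : {i // i ∈ α}) → Fin (S i.1)) : 0 ≤ marginalPMF S p α x :=
  Finset.sum_nonneg fun y _ => by split_ifs <;> simp [hp]

lemma sum_ite_forall_eq {M : Type*} [AddCommMonoid M] (α : Finset (Fin n))
    (y : (i : Fin n) → Fin (S i)) (F : ((i : {i // i ∈ α}) → Fin (S i.1)) → M) :
    (∑ x : (i : {i // i ∈ α}) → Fin (S i.1), if ∀ i : {i // i ∈ α}, y i.1 = x i then F x else 0) =
      F fun i => y i.1 := by
  refine (Fintype.sum_eq_single (fun i : {i // i ∈ α} => y i.1) fun x hx =>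
    if_neg fun h => hx (funext fun i => (h i).symm)).trans (if_pos fun _ => rfl)

lemma sum_marginalPMF (α : Finset (Fin n)) : ∑ x, marginalPMF S p α x = ∑ y, p y := by
  simp only [marginalPMF]
  rw [Finset.sum_comm]
  exact Finset.sum_congr rfl fun y _ => sum_ite_forall_eq α y fun _ => p y

lemma map_restrict_cellMixture {c : Fin n → ℝ} (hc : ∀ i, 0 < c i) (hp : ∀ x, 0 ≤ p x)
    (α : Finset (Fin n)) :
    (cellMixture c p).map (fun ω (i : {i // i ∈ α}) => ω i.1) =
      cellMixture (fun i : {i // i ∈ α} => c i.1) (marginalPMF S p α) := by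
  have h_meas : Measurable fun (ω : Fin n → ℝ) (i : {i // i ∈ α}) => ω i.1 := by fun_prop
  have h_prob := fun (x : (i : Fin n) → Fin (S i)) i =>
    isProbabilityMeasure_cellMeasure (hc i) (x i)
  have h_map (y : (i : Fin n) → Fin (S i)) :
      (Measure.pi fun i => cellMeasure (c i) (y i)).map (fun ω (i : {i // i ∈ α}) => ω i.1) =
        Measure.pi fun i : {i // i ∈ α} => cellMeasure (c i.1) (y i.1) := by
    rw [← Measure.infinitePi_eq_pi]
    exact Measure.infinitePi_map_restrict _
  have h_weight (x : (i : {i // i ∈ α}) → Fin (S i.1)) : ENNReal.ofReal (marginalPMF S p α x) =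
      ∑ y : (i : Fin n) → Fin (S i),
        if ∀ i : {i // i ∈ α}, y i.1 = x i then ENNReal.ofReal (p y) else 0 := by
    rw [marginalPMF, ENNReal.ofReal_sum_of_nonneg fun y _ => by split_ifs <;> simp [hp]]
    exact Finset.sum_congr rfl fun y _ => by split_ifs <;> simp
  simp only [cellMixture]
  rw [Measure.map_finset_sum h_meas.aemeasurable]
  simp_rw [Measure.map_smul, h_map, h_weight, Finset.sum_smul, ite_smul, zero_smul]
  rw [Finset.sum_comm]
  exact Finset.sum_congr rfl fun y _ => (sum_ite_forall_eq α y fun x =>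
    ENNReal.ofReal (p y) • Measure.pi fun i : {i // i ∈ α} => cellMeasure (c i.1) (x i)).symm

lemma discEntropyFn_empty (hp : ∑ x, p x = 1) : discEntropyFn S p ∅ = 0 := by
  have h (x : (i : {i // i ∈ (∅ : Finset (Fin n))}) → Fin (S i.1)) :
      marginalPMF S p ∅ x = 1 := by
    simp [marginalPMF, hp]
  simp [discEntropyFn, h]

end Marginal

/-- let `g` be the Shannon entropy function of finitely-valued discrete
random variables with joint pmf `p`. For positive reals `c_i`, the rank function
`g*(α) = g(α) − ∑_{i∈α} log₂ c_i` is s-entropic. -/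
theorem stmt16 (n : ℕ) (S : Fin n → ℕ) (p : ((i : Fin n) → Fin (S i)) → ℝ)
    (hp : ∀ x, 0 ≤ p x) (hp1 : ∑ x, p x = 1)
    (g : Finset (Fin n) → ℝ) (hg : ∀ α, g α = discEntropyFn S p α)
    (c : Fin n → ℝ) (hc : ∀ i, 0 < c i)
    (g' : Finset (Fin n) → ℝ)
    (hg' : ∀ α : Finset (Fin n), g' α = g α - ∑ i ∈ α, Real.logb 2 (c i)) :
    IsSEntropic n g' := by
  have h_prob := isProbabilityMeasure_cellMixture hc hp hp1
  refine ⟨Fin n → ℝ, ⟨cellMixture c p⟩, fun i ω => ω i, h_prob, measurable_id,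
    ⟨cellDensity c p, measurable_cellDensity, cellDensity_nonneg hc hp,
      Measure.map_id.trans (cellMixture_eq_withDensity hc hp)⟩,
    by simp [hg', hg, discEntropyFn_empty hp1], fun α _ => ?_⟩
  have hcα : ∀ i : {i // i ∈ α}, 0 < c i.1 := fun i => hc i.1
  have hq := marginalPMF_nonneg hp α
  refine ⟨cellDensity (fun i : {i // i ∈ α} => c i.1) (marginalPMF S p α),
    measurable_cellDensity, cellDensity_nonneg hcα hq,
    (map_restrict_cellMixture hc hp α).trans (cellMixture_eq_withDensity hcα hq),
    integrable_cellDensity_mul_logb hcα, ?_⟩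
  rw [integral_cellDensity_mul_logb hcα, sum_marginalPMF, hp1, one_mul, hg', hg, discEntropyFn,
    Finset.sum_coe_sort α fun i => Real.logb 2 (c i)]
  ring

end
end

section
/- The closure of the set of v-entropic functions equals the closure of the set of s-entropic functions: closure(γ*_{v,n}) = closure(γ*_{s,n}). That is, replacing real-valued random variables by random vectors does not enlarge the closure of the region of differential entropy functions. -/
open MeasureTheory

noncomputable section

section Isomorphism

variable {X Y : Type*} [MeasurableSpace X] [MeasurableSpace Y]

/-- There is a measure-preserving map from `(X, μ)` to `(Y, ν)` which has a measurable left
inverse almost everywhere. -/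
def AEEmbeds (μ : Measure X) (ν : Measure Y) : Prop :=
  ∃ (T : X → Y) (S : Y → X), MeasurePreserving T μ ν ∧ Measurable S ∧ ∀ᵐ x ∂μ, S (T x) = x

theorem aeEmbeds_of_injOn [StandardBorelSpace X] [MeasurableSpace.CountablySeparated Y]
    [Nonempty X] {μ : Measure X} {ν : Measure Y} {T : X → Y} (hT : MeasurePreserving T μ ν)
    {N : Set X} (hN : μ N = 0) (hinj : Set.InjOn T Nᶜ) : AEEmbeds μ ν := by
  have hA : MeasurableSet (toMeasurable μ N)ᶜ := (measurableSet_toMeasurable μ N).compl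
  have hAN : (toMeasurable μ N)ᶜ ⊆ Nᶜ := Set.compl_subset_compl.2 (subset_toMeasurable μ N)
  have : StandardBorelSpace ↥(toMeasurable μ N)ᶜ := hA.standardBorel
  have hemb : MeasurableEmbedding (fun x : ↥(toMeasurable μ N)ᶜ => T x) :=
    (hT.measurable.comp measurable_subtype_coe).measurableEmbedding
      fun x y hxy => Subtype.ext (hinj (hAN x.2) (hAN y.2) hxy)
  obtain ⟨S, hS, hST⟩ := hemb.exists_measurable_extend measurable_subtype_coe fun _ => inferInstance
  refine ⟨T, S, hT, hS, ?_⟩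
  have h0 : ∀ᵐ x ∂μ, x ∉ toMeasurable μ N := by
    rw [← measure_toMeasurable] at hN
    exact measure_eq_zero_iff_ae_notMem.1 hN
  filter_upwards [h0] with x hx
  exact congrFun hST ⟨x, hx⟩

theorem continuous_cdf (μ : Measure ℝ) [IsProbabilityMeasure μ] [NullSingletonClass μ] :
    Continuous (ProbabilityTheory.cdf μ) := by
  refine continuous_iff_continuousAt.2 fun a => continuousAt_iff_continuous_left'_right'.2
    ⟨?_, ((ProbabilityTheory.cdf μ).right_continuous a).mono Set.Ioi_subset_Ici_self⟩
  have h := (ProbabilityTheory.cdf μ).measure_singleton a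
  rw [ProbabilityTheory.measure_cdf, measure_singleton] at h
  have h1 := ENNReal.ofReal_eq_zero.1 h.symm
  exact (Monotone.continuousWithinAt_Iio_iff_leftLim_eq (ProbabilityTheory.cdf μ).mono).2
    (le_antisymm ((ProbabilityTheory.cdf μ).mono.leftLim_le le_rfl) (by linarith))

theorem measurePreserving_cdf (μ : Measure ℝ) [IsProbabilityMeasure μ] [NullSingletonClass μ] :
    MeasurePreserving (ProbabilityTheory.cdf μ) μ (volume.restrict (Set.Ico 0 1)) := by
  set F := ProbabilityTheory.cdf μ with hF
  have hcont : Continuous F := continuous_cdf μ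
  have hbot := ProbabilityTheory.tendsto_cdf_atBot μ
  have htop := ProbabilityTheory.tendsto_cdf_atTop μ
  refine ⟨hcont.measurable, ?_⟩
  have : IsProbabilityMeasure (μ.map F) :=
    Measure.isProbabilityMeasure_map hcont.measurable.aemeasurable
  have key : ∀ t : ℝ, 0 < t → t < 1 → μ (F ⁻¹' Set.Iic t) = ENNReal.ofReal t := by
    intro t h0 h1
    obtain ⟨a, ha⟩ := (hbot.eventually (gt_mem_nhds h0)).exists
    obtain ⟨b, hb⟩ := (htop.eventually (lt_mem_nhds h1)).exists
    have hbdd : BddAbove (F ⁻¹' Set.Iic t) :=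
      ⟨b, fun x hx => le_of_not_gt fun hbx =>
        absurd (hb.trans_le (F.mono hbx.le)) (not_lt.2 hx)⟩
    have hmem : sSup (F ⁻¹' Set.Iic t) ∈ F ⁻¹' Set.Iic t :=
      (isClosed_Iic.preimage hcont).csSup_mem ⟨a, ha.le⟩ hbdd
    set s := sSup (F ⁻¹' Set.Iic t) with hs
    have hset : F ⁻¹' Set.Iic t = Set.Iic s := by
      ext x
      exact ⟨fun hx => le_csSup hbdd hx, fun hx => (F.mono hx).trans hmem⟩
    obtain ⟨y, hy⟩ := mem_range_of_exists_le_of_exists_ge hcont ⟨a, ha.le⟩ ⟨b, hb.le⟩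
    have hst : F s = t := le_antisymm hmem (hy ▸ F.mono (le_csSup hbdd (by simp [hy])))
    rw [hset, ← ProbabilityTheory.ofReal_cdf, ← hF, hst]
  refine Measure.ext_of_Iic _ _ fun t => ?_
  rw [Measure.map_apply hcont.measurable measurableSet_Iic,
    Measure.restrict_apply measurableSet_Iic]
  rcases lt_or_ge t 1 with h1 | h1
  · have hR : volume (Set.Iic t ∩ Set.Ico 0 1) = ENNReal.ofReal t := by
      have : Set.Iic t ∩ Set.Ico 0 1 = Set.Icc 0 t := by
        ext x; simp only [Set.mem_inter_iff, Set.mem_Iic, Set.mem_Ico, Set.mem_Icc]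
        constructor
        · rintro ⟨h, h', h''⟩; exact ⟨h', h⟩
        · rintro ⟨h, h'⟩; exact ⟨h', h, by linarith⟩
      simp [this]
    rw [hR]
    rcases lt_or_ge 0 t with h0 | h0
    · exact key t h0 h1
    · rw [ENNReal.ofReal_eq_zero.2 h0]
      refine le_antisymm (ENNReal.le_of_forall_pos_le_add fun ε hε _ => ?_) zero_le
      have hδ : (0 : ℝ) < min ε (1 / 2) := lt_min hε (by norm_num)
      calc μ (F ⁻¹' Set.Iic t) ≤ μ (F ⁻¹' Set.Iic (min ε (1 / 2))) :=
            measure_mono (Set.preimage_mono (Set.Iic_subset_Iic.2 (h0.trans hδ.le)))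
        _ = ENNReal.ofReal (min ε (1 / 2)) :=
            key _ hδ ((min_le_right _ _).trans_lt (by norm_num))
        _ ≤ ENNReal.ofReal ε := ENNReal.ofReal_le_ofReal (min_le_left _ _)
        _ = 0 + ε := by simp
  · have hL : F ⁻¹' Set.Iic t = Set.univ :=
      Set.eq_univ_of_forall fun x => (ProbabilityTheory.cdf_le_one μ x).trans h1
    have hR : Set.Iic t ∩ Set.Ico 0 1 = Set.Ico 0 1 :=
      Set.inter_eq_right.2 fun x hx => hx.2.le.trans h1
    simp [hL, hR]

theorem aeEmbeds_unitInterval [StandardBorelSpace X] (μ : Measure X) [IsProbabilityMeasure μ]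
    [NullSingletonClass μ] : AEEmbeds μ ((volume : Measure ℝ).restrict (Set.Ico 0 1)) := by
  obtain ⟨e, he⟩ := exists_measurableEmbedding_real X
  have : Nonempty X := μ.nonempty_of_neZero
  have : IsProbabilityMeasure (μ.map e) :=
    Measure.isProbabilityMeasure_map he.measurable.aemeasurable
  have : NullSingletonClass (μ.map e) := ⟨fun r => by
    rw [he.map_apply]
    exact (Set.subsingleton_singleton.preimage he.injective).measure_zero μ⟩
  set F := ProbabilityTheory.cdf (μ.map e)
  have hF := measurePreserving_cdf (μ.map e)
  refine aeEmbeds_of_injOn (hF.comp ⟨he.measurable, rfl⟩)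
    (N := e ⁻¹' ⋃ q : ℚ, F ⁻¹' {F q} ∩ Set.Iio (q : ℝ)) ?_ ?_
  · rw [← he.map_apply]
    refine measure_iUnion_null fun q => measure_mono_null Set.inter_subset_left ?_
    rw [← Measure.map_apply hF.measurable (measurableSet_singleton _), hF.map_eq]
    exact measure_singleton _
  · have key : ∀ x ∈ (e ⁻¹' ⋃ q : ℚ, F ⁻¹' {F q} ∩ Set.Iio (q : ℝ))ᶜ, ∀ y,
        F (e x) = F (e y) → ¬ e x < e y := by
      intro x hx y hxy hlt
      obtain ⟨q, h1, h2⟩ := exists_rat_btwn hlt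
      exact hx (Set.mem_iUnion.2 ⟨q, le_antisymm (F.mono h1.le) (hxy ▸ F.mono h2.le), h1⟩)
    intro x hx y hy hxy
    exact he.injective (le_antisymm (not_lt.1 (key y hy x hxy.symm)) (not_lt.1 (key x hx y hxy)))

theorem sum_restrict_fiber {ι : Type*} [Countable ι] [MeasurableSpace ι]
    [MeasurableSingletonClass ι] (μ : Measure X) {c : X → ι} (hc : Measurable c) :
    Measure.sum (fun i => μ.restrict (c ⁻¹' {i})) = μ := by
  have hd : Pairwise (Function.onFun Disjoint fun i => c ⁻¹' {i}) := fun i j hij =>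
    Set.disjoint_left.2 fun x hx hx' => hij ((Set.mem_singleton_iff.1 hx).symm.trans hx')
  rw [← Measure.restrict_iUnion hd fun i => hc (measurableSet_singleton i), ← Set.preimage_iUnion, Set.iUnion_of_singleton, Set.preimage_univ, Measure.restrict_univ]

theorem aeEmbeds_real [StandardBorelSpace X] {ι : Type*} [MeasurableSpace ι]
    [MeasurableSingletonClass ι] (e : ι ≃ ℤ) (μ : Measure X) [NullSingletonClass μ]
    {c : X → ι} (hc : Measurable c) (hμ : ∀ i, μ (c ⁻¹' {i}) = 1) :
    AEEmbeds μ (volume : Measure ℝ) := by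
  have : Countable ι := e.countable_iff.2 inferInstance
  have hemb : ∀ i, AEEmbeds (μ.restrict (c ⁻¹' {i}))
      ((volume : Measure ℝ).restrict (Set.Ico 0 1)) := fun i => by
    have : IsProbabilityMeasure (μ.restrict (c ⁻¹' {i})) := ⟨by simp [hμ i]⟩
    exact aeEmbeds_unitInterval _
  choose T S hT hS hST using hemb
  set G : X → ℝ := fun x => T (c x) x + (e (c x) : ℝ) with hG
  have hGm : Measurable G := by
    have : Measurable fun p : ι × X => T p.1 p.2 + (e p.1 : ℝ) :=
      measurable_from_prod_countable_right fun i =>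
        (hT i).measurable.add_const (e i : ℝ)
    exact this.comp (hc.prodMk measurable_id)
  have hcell : ∀ i, ∀ᵐ x ∂μ.restrict (c ⁻¹' {i}), c x = i := fun i =>
    ae_restrict_mem (hc (measurableSet_singleton i))
  refine ⟨G, fun r => S (e.symm ⌊r⌋) (Int.fract r), ⟨hGm, ?_⟩, ?_, ?_⟩
  · have hmap : ∀ i, (μ.restrict (c ⁻¹' {i})).map G
        = (volume : Measure ℝ).restrict (Int.floor ⁻¹' {e i}) := by
      intro i
      have h1 : (μ.restrict (c ⁻¹' {i})).map G
          = ((μ.restrict (c ⁻¹' {i})).map (T i)).map (fun r => r + (e i : ℝ)) := by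
        rw [Measure.map_map (measurable_add_const _) (hT i).measurable]
        refine Measure.map_congr ?_
        filter_upwards [hcell i] with x hx
        simp [hG, hx]
      have h2 : Set.Ico (0 : ℝ) 1 = (fun r => r + (e i : ℝ)) ⁻¹' (Int.floor ⁻¹' {e i}) := by
        rw [Int.preimage_floor_singleton]
        simp
      rw [h1, (hT i).map_eq, h2]
      exact ((measurePreserving_add_right volume (e i : ℝ)).restrict_preimage
        (Int.measurable_floor (measurableSet_singleton _))).map_eq
    conv_lhs => rw [← sum_restrict_fiber μ hc]
    rw [Measure.map_sum hGm.aemeasurable]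
    simp_rw [hmap]
    refine (Measure.sum_comp_equiv e
      fun n : ℤ => (volume : Measure ℝ).restrict (Int.floor ⁻¹' {n})).trans ?_
    exact sum_restrict_fiber volume Int.measurable_floor
  · have : Measurable fun p : ι × ℝ => S p.1 p.2 := measurable_from_prod_countable_right hS
    have he : Measurable fun r : ℝ => e.symm ⌊r⌋ :=
      (measurable_of_countable e.symm).comp Int.measurable_floor
    exact this.comp (he.prodMk measurable_fract)
  · rw [← sum_restrict_fiber μ hc, Measure.ae_sum_iff]
    intro i
    have hT01 : ∀ᵐ x ∂μ.restrict (c ⁻¹' {i}), T i x ∈ Set.Ico (0 : ℝ) 1 :=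
      (hT i).quasiMeasurePreserving.ae (ae_restrict_mem measurableSet_Ico)
    filter_upwards [hcell i, hST i, hT01] with x hx hx' hx''
    have hfl : ⌊G x⌋ = e i := by
      simp [hG, hx, Int.floor_eq_zero_iff.2 hx'']
    have hfr : Int.fract (G x) = T i x := by
      rw [Int.fract, hfl]; simp [hG, hx]
    rw [hfl, hfr, Equiv.symm_apply_apply, hx']

theorem aeEmbeds_pi_real {ι : Type*} [Fintype ι] [Nonempty ι] :
    AEEmbeds (volume : Measure (ι → ℝ)) (volume : Measure ℝ) := by
  obtain ⟨e⟩ : Nonempty ((ι → ℤ) ≃ ℤ) := nonempty_equiv_of_countable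
  refine aeEmbeds_real e volume (c := fun x i => ⌊x i⌋)
    (measurable_pi_lambda _ fun i => Int.measurable_floor.comp (measurable_pi_apply i)) fun z => ?_
  have : (fun (x : ι → ℝ) i => ⌊x i⌋) ⁻¹' {z}
      = Set.univ.pi fun i => Set.Ico (z i : ℝ) (z i + 1) := by
    ext x
    simp [funext_iff, Int.floor_eq_iff]
  rw [this, Real.volume_pi_Ico]
  simp

theorem measurePreserving_pi_and_ae_leftInverse {ι : Type*} [Fintype ι] {A B : ι → Type*} [∀ i, MeasureSpace (A i)]
    [∀ i, MeasureSpace (B i)] [∀ i, SigmaFinite (volume : Measure (A i))]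
    [∀ i, SigmaFinite (volume : Measure (B i))]
    {T : ∀ i, A i → B i} {S : ∀ i, B i → A i} (hT : ∀ i, MeasurePreserving (T i))
    (hST : ∀ i, ∀ᵐ x, S i (T i x) = x) :
    MeasurePreserving (fun (a : ∀ i, A i) i => T i (a i)) ∧
      ∀ᵐ a : ∀ i, A i, (fun i => S i (T i (a i))) = a := by
  refine ⟨volume_preserving_pi hT, ?_⟩
  filter_upwards [Filter.eventually_all.2 fun i =>
    (Measure.quasiMeasurePreserving_eval (fun i => (volume : Measure (A i))) i).ae (hST i)]
    with a ha
  exact funext ha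

end Isomorphism

section Transfer

variable {X Y : Type*} [MeasureSpace X] [MeasureSpace Y] {P : X → Y} {Q : Y → X} {f : X → ℝ}

theorem map_withDensity_of_leftInverse (hP : MeasurePreserving P) (hQ : Measurable Q)
    (hQP : ∀ᵐ x, Q (P x) = x) (hf : Measurable f) :
    (volume.withDensity fun x => ENNReal.ofReal (f x)).map P
      = volume.withDensity fun y => ENNReal.ofReal (f (Q y)) := by
  ext s hs
  rw [Measure.map_apply hP.measurable hs, withDensity_apply _ (hP.measurable hs),
    withDensity_apply _ hs,
    ← hP.setLIntegral_comp_preimage hs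
      (f := fun y => ENNReal.ofReal (f (Q y))) ((hf.comp hQ).ennreal_ofReal)]
  refine lintegral_congr_ae (ae_restrict_of_ae ?_)
  filter_upwards [hQP] with x hx
  simp [hx]

theorem integrable_comp_leftInverse (hP : MeasurePreserving P) (hQ : Measurable Q)
    (hQP : ∀ᵐ x, Q (P x) = x) (hf : Measurable f) (hi : Integrable f) :
    Integrable (fun y => f (Q y)) := by
  have hfQ : AEStronglyMeasurable (fun y => f (Q y)) := (hf.comp hQ).aestronglyMeasurable
  refine (hP.integrable_comp hfQ).1 (hi.congr ?_)
  filter_upwards [hQP] with x hx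
  simp [hx]

theorem integral_comp_leftInverse (hP : MeasurePreserving P) (hQ : Measurable Q)
    (hQP : ∀ᵐ x, Q (P x) = x) (hf : Measurable f) :
    ∫ y, f (Q y) = ∫ x, f x := by
  rw [← hP.map_eq, integral_map (f := fun y => f (Q y)) hP.measurable.aemeasurable
    (hf.comp hQ).aestronglyMeasurable]
  refine integral_congr_ae ?_
  filter_upwards [hQP] with x hx
  simp [hx]

variable {Ω : Type*} [MeasureSpace Ω] {Z : Ω → X}

theorem density_transfer (hP : MeasurePreserving P) (hQ : Measurable Q)
    (hQP : ∀ᵐ x, Q (P x) = x) (hZ : Measurable Z)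
    (h : ∃ f : X → ℝ, Measurable f ∧ (∀ x, 0 ≤ f x) ∧
      Measure.map Z volume = volume.withDensity fun x => ENNReal.ofReal (f x)) :
    ∃ f : Y → ℝ, Measurable f ∧ (∀ y, 0 ≤ f y) ∧
      Measure.map (fun ω => P (Z ω)) volume
        = volume.withDensity fun y => ENNReal.ofReal (f y) := by
  obtain ⟨f, hf, hf0, hmap⟩ := h
  refine ⟨fun y => f (Q y), hf.comp hQ, fun y => hf0 _, ?_⟩
  rw [← map_withDensity_of_leftInverse hP hQ hQP hf, ← hmap, Measure.map_map hP.measurable hZ]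
  rfl

theorem entropy_transfer (hP : MeasurePreserving P) (hQ : Measurable Q)
    (hQP : ∀ᵐ x, Q (P x) = x) (hZ : Measurable Z) {r : ℝ}
    (h : ∃ f : X → ℝ, Measurable f ∧ (∀ x, 0 ≤ f x) ∧
      Measure.map Z volume = volume.withDensity (fun x => ENNReal.ofReal (f x)) ∧
      Integrable (fun x => f x * Real.logb 2 (f x)) ∧
      r = -∫ x, f x * Real.logb 2 (f x)) :
    ∃ f : Y → ℝ, Measurable f ∧ (∀ y, 0 ≤ f y) ∧
      Measure.map (fun ω => P (Z ω)) volume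
        = volume.withDensity (fun y => ENNReal.ofReal (f y)) ∧
      Integrable (fun y => f y * Real.logb 2 (f y)) ∧
      r = -∫ y, f y * Real.logb 2 (f y) := by
  obtain ⟨f, hf, hf0, hmap, hi, hr⟩ := h
  have hfm : Measurable fun x => f x * Real.logb 2 (f x) := hf.mul (by unfold Real.logb; fun_prop)
  refine ⟨fun y => f (Q y), hf.comp hQ, fun y => hf0 _, ?_,
    integrable_comp_leftInverse hP hQ hQP hfm hi, ?_⟩
  · rw [← map_withDensity_of_leftInverse hP hQ hQP hf, ← hmap, Measure.map_map hP.measurable hZ]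
    rfl
  · rw [hr, integral_comp_leftInverse hP hQ hQP hfm]

end Transfer

theorem IsVEntropic.isSEntropic {n : ℕ} {g : Finset (Fin n) → ℝ} (h : IsVEntropic n g) :
    IsSEntropic n g := by
  obtain ⟨k, hk, Ω, m, X, hprob, hX, hjoint, h0, hα⟩ := h
  have hemb : ∀ i, AEEmbeds (volume : Measure (Fin (k i) → ℝ)) (volume : Measure ℝ) := fun i => by
    have : Nonempty (Fin (k i)) := ⟨⟨0, hk i⟩⟩
    exact aeEmbeds_pi_real
  choose T S hT hS hST using hemb
  have hXi : ∀ i, Measurable (X i) := measurable_pi_iff.1 hX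
  refine ⟨Ω, m, fun i ω => T i (X i ω), hprob,
    measurable_pi_lambda _ fun i => (hT i).measurable.comp (hXi i), ?_, h0, fun α hne => ?_⟩
  · obtain ⟨h1, h2⟩ := measurePreserving_pi_and_ae_leftInverse hT hST
    exact density_transfer h1 (Q := fun (y : Fin n → ℝ) i => S i (y i))
      (measurable_pi_lambda _ fun i => (hS i).comp (measurable_pi_apply i)) h2 hX hjoint
  · obtain ⟨h1, h2⟩ := measurePreserving_pi_and_ae_leftInverse (fun i : {i // i ∈ α} => hT i.1) (fun i => hST i.1)
    exact entropy_transfer h1 (Q := fun (y : {i // i ∈ α} → ℝ) i => S i.1 (y i))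
      (measurable_pi_lambda _ fun i => (hS i.1).comp (measurable_pi_apply i)) h2
      (measurable_pi_lambda _ fun i => hXi i.1) (hα α hne)

theorem IsSEntropic.isVEntropic {n : ℕ} {g : Finset (Fin n) → ℝ} (h : IsSEntropic n g) :
    IsVEntropic n g := by
  obtain ⟨Ω, m, X, hprob, hX, hjoint, h0, hα⟩ := h
  have hT : MeasurePreserving (fun (r : ℝ) (_ : Fin 1) => r) :=
    (volume_preserving_funUnique (Fin 1) ℝ).symm _
  have hS : Measurable fun v : Fin 1 → ℝ => v 0 := measurable_pi_apply 0
  have hXi : ∀ i, Measurable (X i) := measurable_pi_iff.1 hX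
  refine ⟨fun _ => 1, fun _ => one_pos, Ω, m, fun i ω _ => X i ω, hprob,
    measurable_pi_lambda _ fun i => hT.measurable.comp (hXi i), ?_, h0, fun α hne => ?_⟩
  · obtain ⟨h1, h2⟩ := measurePreserving_pi_and_ae_leftInverse (fun _ : Fin n => hT) (S := fun _ v => v 0)
      fun _ => Filter.Eventually.of_forall fun _ => rfl
    exact density_transfer h1 (Q := fun y i => y i 0)
      (measurable_pi_lambda _ fun i => hS.comp (measurable_pi_apply i)) h2 hX hjoint
  · obtain ⟨h1, h2⟩ := measurePreserving_pi_and_ae_leftInverse (fun _ : {i // i ∈ α} => hT) (S := fun _ v => v 0)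
      fun _ => Filter.Eventually.of_forall fun _ => rfl
    exact entropy_transfer h1 (Q := fun y i => y i 0)
      (measurable_pi_lambda _ fun i => hS.comp (measurable_pi_apply i)) h2
      (measurable_pi_lambda _ fun i => hXi i.1) (hα α hne)

/-- `closure(γ*_{v,n}) = closure(γ*_{s,n})`: replacing real-valued random
variables by random vectors does not enlarge the closure of the region of differential
entropy functions. -/
theorem stmt17 (n : ℕ) :
    closure {g : Finset (Fin n) → ℝ | IsVEntropic n g} =
      closure {g : Finset (Fin n) → ℝ | IsSEntropic n g} := by
  have h : ∀ g : Finset (Fin n) → ℝ, IsVEntropic n g ↔ IsSEntropic n g := fun _ =>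
    ⟨IsVEntropic.isSEntropic, IsSEntropic.isVEntropic⟩
  simp only [h]

end
end

section
/- If a rank function g is v-representable, then g ∈ W̄(Υ_{v,n}), i.e. g lies in the closure of the set {c·g' : c > 0, g' ∈ Υ_{v,n}}. -/
open MeasureTheory

noncomputable section

open Filter Topology in
/-- On a logarithmic scale, `1 + t * a` grows like `t` if `a > 0` and stays bounded if `a = 0`. -/
theorem tendsto_logb_one_add_mul_div_logb {a : ℝ} (ha : 0 ≤ a) :
    Tendsto (fun t : ℝ => Real.logb 2 (1 + t * a) / Real.logb 2 t) atTop
      (𝓝 (if a ≠ 0 then 1 else 0)) := by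
  have hlog : Tendsto (Real.logb 2) atTop atTop := Real.tendsto_logb_atTop one_lt_two
  split_ifs with h
  · have hlim : Tendsto (fun t : ℝ => Real.logb 2 (t⁻¹ + a)) atTop (𝓝 (Real.logb 2 a)) := by
      have h0 : Tendsto (fun t : ℝ => t⁻¹ + a) atTop (𝓝 a) := by
        simpa using tendsto_inv_atTop_zero.add_const a
      exact h0.logb h
    have hsum := (hlim.div_atTop hlog).const_add 1
    rw [add_zero] at hsum
    refine hsum.congr' ?_
    filter_upwards [eventually_gt_atTop 1] with t ht
    have ht0 : (0 : ℝ) < t := by linarith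
    have hfac : 1 + t * a = t * (t⁻¹ + a) := by field_simp
    have hlt : Real.logb 2 t ≠ 0 := (Real.logb_pos one_lt_two ht).ne'
    rw [hfac, Real.logb_mul ht0.ne' (by positivity), add_div, div_self hlt]
  · push Not at h
    simp [h]

/-- The determinant of `1 + t • M` in terms of the eigenvalues of the Hermitian matrix `M`. -/
theorem Matrix.IsHermitian.det_one_add_smul_eq_prod {m : Type*} [Fintype m] [DecidableEq m]
    {M : Matrix m m ℝ} (hM : M.IsHermitian) {t : ℝ} (ht : t ≠ 0) :
    (1 + t • M).det = ∏ i, (1 + t * hM.eigenvalues i) := by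
  have hfac : 1 + t • M = (-t) • (Matrix.scalar m (-t⁻¹) - M) := by
    ext i j
    by_cases hij : i = j
    · subst hij
      simp [mul_sub, ht]
    · simp [hij]
  rw [hfac, Matrix.det_smul, ← Matrix.eval_charpoly, hM.charpoly_eq, Polynomial.eval_prod,
    Fintype.card, ← Finset.prod_const, ← Finset.prod_mul_distrib]
  refine Finset.prod_congr rfl fun i _ => ?_
  simp [mul_sub, ht]

open Filter Topology in
/-- The rank of `B` is the growth rate of `log det (1 + t B Bᵀ)` relative to `log t`. -/
theorem tendsto_logb_det_one_add_smul_div_logb {m d : Type*} [Fintype m] [DecidableEq m]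
    [Fintype d] (B : Matrix m d ℝ) {c : ℝ} (hc : 0 < c) :
    Tendsto (fun t : ℝ => Real.logb 2 (c * (1 + t • (B * B.transpose)).det) / Real.logb 2 t) atTop
      (𝓝 (B.rank : ℝ)) := by
  have hpos : (B * B.transpose).PosSemidef := by
    simpa using Matrix.posSemidef_self_mul_conjTranspose B
  have hnonneg := hpos.eigenvalues_nonneg
  have hrank : (B.rank : ℝ) =
      0 + ∑ i, if hpos.isHermitian.eigenvalues i ≠ 0 then (1 : ℝ) else 0 := by
    rw [← Matrix.rank_self_mul_transpose, hpos.isHermitian.rank_eq_card_non_zero_eigs,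
      Fintype.card_subtype, Finset.sum_boole, zero_add]
  rw [hrank]
  have hconst : Tendsto (fun t : ℝ => Real.logb 2 c / Real.logb 2 t) atTop (𝓝 0) :=
    tendsto_const_nhds.div_atTop (Real.tendsto_logb_atTop one_lt_two)
  refine (hconst.add (tendsto_finsetSum _ fun i _ =>
    tendsto_logb_one_add_mul_div_logb (hnonneg i))).congr' ?_
  filter_upwards [eventually_gt_atTop 0] with t ht
  have hfactor : ∀ i, 1 + t * hpos.isHermitian.eigenvalues i ≠ 0 := fun i => by
    have := mul_nonneg ht.le (hnonneg i)
    positivity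
  rw [hpos.isHermitian.det_one_add_smul_eq_prod ht.ne', Real.logb_mul hc.ne'
    (Finset.prod_ne_zero_iff.2 fun i _ => hfactor i), Real.logb_prod _ _ fun i _ => hfactor i,
    add_div, Finset.sum_div]

/-- every v-representable rank function lies in `W̄(Υ_{v,n})`, the closure
of the set of positive scalar multiples of v-Gaussian functions. -/
theorem stmt18 (n : ℕ) (g : Finset (Fin n) → ℝ) (hg : IsVRepresentable n g) :
    g ∈ closure (Wscale {g' : Finset (Fin n) → ℝ | IsVGaussian n g'}) := by
  obtain ⟨d, k, A, hA⟩ := hg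
  -- Appending a zero vector to each block makes all block lengths positive.
  let B : Matrix ((i : Fin n) × Fin (k i + 1)) (Fin d) ℝ :=
    Matrix.of fun p => Fin.cons (α := fun _ => Fin d → ℝ) 0 (A p.1) p.2
  let Bsub (α : Finset (Fin n)) : Matrix {p : (i : Fin n) × Fin (k i + 1) // p.1 ∈ α} (Fin d) ℝ :=
    B.submatrix (fun p => p.1) id
  let K (t : ℝ) := 1 + t • (B * B.transpose)
  have hsub (t : ℝ) (α : Finset (Fin n)) :
      vPrincipal (K t) α = 1 + t • (Bsub α * (Bsub α).transpose) := by
    ext p q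
    simp [vPrincipal, K, Bsub, Matrix.mul_apply, Matrix.one_apply, Subtype.ext_iff]
  have hrank (α : Finset (Fin n)) : g α = ((Bsub α).rank : ℝ) := by
    have hspan : Submodule.span ℝ {v : Fin d → ℝ | ∃ i ∈ α, ∃ j, v = A i j} =
        Submodule.span ℝ (Set.range (Bsub α).row) := by
      apply le_antisymm
      · refine Submodule.span_mono ?_
        rintro v ⟨i, hi, j, rfl⟩
        exact ⟨⟨⟨i, j.succ⟩, hi⟩, by ext x; simp [Bsub, B, Matrix.row]⟩
      · rw [Submodule.span_le]
        rintro v ⟨⟨⟨i, j⟩, hi⟩, rfl⟩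
        refine Fin.cases ?_ (fun j => ?_) j
        · exact Submodule.zero_mem (Submodule.span ℝ _)
        · exact Submodule.subset_span ⟨i, hi, j, by ext x; simp [Bsub, B, Matrix.row]⟩
    rw [hA, Matrix.rank_eq_finrank_span_row, hspan]
  let e (t : ℝ) (α : Finset (Fin n)) : ℝ :=
    1 / 2 * Real.logb 2
      ((2 * Real.pi * Real.exp 1) ^ (∑ i ∈ α, (k i + 1)) * (vPrincipal (K t) α).det)
  refine mem_closure_of_tendsto (b := Filter.atTop)
    (f := fun t : ℝ => (2 / Real.logb 2 t) • e t) ?_ ?_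
  · rw [tendsto_pi_nhds]
    intro α
    rw [hrank]
    refine (tendsto_logb_det_one_add_smul_div_logb (Bsub α)
      (c := (2 * Real.pi * Real.exp 1) ^ (∑ i ∈ α, (k i + 1))) (by positivity)).congr fun t => ?_
    simp only [Pi.smul_apply, smul_eq_mul, e, hsub]
    ring
  · filter_upwards [Filter.eventually_gt_atTop 1] with t ht
    have hpos : (B * B.transpose).PosSemidef := by
      simpa using Matrix.posSemidef_self_mul_conjTranspose B
    exact ⟨2 / Real.logb 2 t, div_pos two_pos (Real.logb_pos one_lt_two ht), e t,
      ⟨fun i => k i + 1, fun i => Nat.succ_pos _, K t,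
        Matrix.PosDef.one.add_posSemidef (hpos.smul (by linarith)), fun α => rfl⟩, rfl⟩

end
end

section
/- The closed convex cone generated by the normalised Gaussian entropy functions equals the closed convex cone generated by the v-Gaussian functions: con(Υ*_{N,n}) = con(Υ_{v,n}). Here a normalised Gaussian entropy function is a rank function of the form g(α) = (1/T)·½ log((2πe)^{T|α|} det Σ_α) for some positive integer T and some symmetric positive definite (nT)×(nT) covariance matrix Σ partitioned into n blocks each of size T, Σ_α being the principal submatrix on the blocks indexed by α. -/
open MeasureTheory

noncomputable section

theorem subset_ccc_of_smul {E : Type*} [AddCommMonoid E] [Module ℝ E] [TopologicalSpace E]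
    {S S' : Set E} (h : ∀ g ∈ S, ∃ c : ℝ, 0 < c ∧ ∃ g' ∈ S', g = c • g') :
    ccc S ⊆ ccc S' := by
  intro x hx C hC
  refine hx C ⟨hC.1, fun g hg => ?_⟩
  obtain ⟨c, hc, g', hg', rfl⟩ := h g hg
  exact hC.1.2.2 c hc g' (hC.2 hg')

theorem posDef_fromBlocks_diagonal {ι κ : Type*} [Fintype ι] [Fintype κ]
    {A : Matrix ι ι ℝ} {D : Matrix κ κ ℝ} (hA : A.PosDef) (hD : D.PosDef) :
    (Matrix.fromBlocks A 0 0 D).PosDef := by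
  classical
  refine Matrix.PosDef.of_dotProduct_mulVec_pos
    (Matrix.IsHermitian.fromBlocks hA.isHermitian (by simp) hD.isHermitian) fun x hx => ?_
  obtain ⟨u, v, rfl⟩ : ∃ u v, x = Sum.elim u v :=
    ⟨x ∘ Sum.inl, x ∘ Sum.inr, (Sum.elim_comp_inl_inr x).symm⟩
  have hs : star (Sum.elim u v) = Sum.elim (star u) (star v) := by
    ext i; cases i <;> rfl
  rw [Matrix.fromBlocks_mulVec, hs, sumElim_dotProduct_sumElim]
  simp only [Matrix.zero_mulVec, add_zero, zero_add, Sum.elim_comp_inl, Sum.elim_comp_inr]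
  by_cases hu : u = 0
  · have hv : v ≠ 0 := by
      rintro rfl
      subst hu
      exact hx (by ext i; cases i <;> rfl)
    exact add_pos_of_nonneg_of_pos (hA.posSemidef.dotProduct_mulVec_nonneg u)
      (hD.dotProduct_mulVec_pos hv)
  · exact add_pos_of_pos_of_nonneg (hA.dotProduct_mulVec_pos hu)
      (hD.posSemidef.dotProduct_mulVec_nonneg v)

/-- Padding a positive definite matrix by an independent scalar block of variance `c⁻¹` leaves
every normalised principal minor `c ^ size * det` unchanged. -/
theorem exists_posDef_padding {ι P N : Type*} [Fintype ι] [DecidableEq ι] [Fintype P]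
    [DecidableEq P] [DecidableEq N] {c : ℝ} (hc : 0 < c) (j : ι → P)
    (hj : Function.Injective j) (π : P → N) {A : Matrix ι ι ℝ} (hA : A.PosDef) :
    ∃ K : Matrix P P ℝ, K.PosDef ∧ ∀ α : Finset N,
      c ^ Fintype.card {p // π p ∈ α} *
          (K.submatrix (fun p : {p // π p ∈ α} => p.1) (fun p => p.1)).det =
        c ^ Fintype.card {x // π (j x) ∈ α} *
          (A.submatrix (fun x : {x // π (j x) ∈ α} => x.1) (fun x => x.1)).det := by
  classical
  let E : ι ⊕ {p // p ∉ Set.range j} ≃ P :=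
    ((Equiv.ofInjective j hj).sumCongr (Equiv.refl _)).trans (Equiv.sumCompl (· ∈ Set.range j))
  have hE : ∀ x, E (Sum.inl x) = j x := fun x => rfl
  let D : Matrix {p // p ∉ Set.range j} {p // p ∉ Set.range j} ℝ := c⁻¹ • 1
  have hD : D.PosDef := Matrix.PosDef.one.smul (inv_pos.2 hc)
  refine ⟨(Matrix.fromBlocks A 0 0 D).submatrix E.symm E.symm,
    (posDef_fromBlocks_diagonal hA hD).submatrix E.symm.injective, fun α => ?_⟩
  let F : {x // π (j x) ∈ α} ⊕ {y : {p // p ∉ Set.range j} // π (E (Sum.inr y)) ∈ α} ≃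
      {p // π p ∈ α} :=
    (Equiv.subtypeSum (p := fun s => π (E s) ∈ α)).symm.trans
      (E.subtypeEquiv fun _ => Iff.rfl)
  rw [← Fintype.card_congr F, Fintype.card_sum, ← Matrix.det_submatrix_equiv_self F]
  have hblock : (((Matrix.fromBlocks A 0 0 D).submatrix E.symm E.symm).submatrix
      (fun p : {p // π p ∈ α} => p.1) (fun p => p.1)).submatrix F F =
      Matrix.fromBlocks (A.submatrix (fun x : {x // π (j x) ∈ α} => x.1) (fun x => x.1)) 0 0
        (c⁻¹ • 1) := by
    have hl : ∀ x, E.symm (F (Sum.inl x)).1 = Sum.inl x.1 := fun x => E.symm_apply_apply _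
    have hr : ∀ y, E.symm (F (Sum.inr y)).1 = Sum.inr y.1 := fun y => E.symm_apply_apply _
    ext s t
    rcases s with s | s <;> rcases t with t | t <;>
      simp [Matrix.submatrix_apply, hl, hr, D, Matrix.one_apply, Subtype.ext_iff]
  rw [hblock, Matrix.det_fromBlocks_zero₂₁, Matrix.det_smul, Matrix.det_one, pow_add, inv_pow]
  field_simp

theorem IsNormGaussian.exists_smul_isVGaussian {n : ℕ} {g : Finset (Fin n) → ℝ}
    (hg : IsNormGaussian n g) : ∃ c : ℝ, 0 < c ∧ ∃ g', IsVGaussian n g' ∧ g = c • g' := by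
  obtain ⟨T, hT, K, hK, h⟩ := hg
  let e := Equiv.sigmaEquivProd (Fin n) (Fin T)
  refine ⟨1 / T, by positivity, _, ⟨fun _ => T, fun _ => hT, K.submatrix e e,
    hK.submatrix e.injective, fun _ => rfl⟩, ?_⟩
  ext α
  rw [h α, Pi.smul_apply, smul_eq_mul, Finset.sum_const, smul_eq_mul, mul_comm T]
  congr 4
  let f : {p : (_ : Fin n) × Fin T // p.1 ∈ α} ≃ {p : Fin n × Fin T // p.1 ∈ α} :=
    e.subtypeEquiv fun _ => Iff.rfl
  exact (Matrix.det_submatrix_equiv_self f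
    (K.submatrix (fun p : {p : Fin n × Fin T // p.1 ∈ α} => p.1) (fun p => p.1))).symm

theorem IsVGaussian.exists_smul_isNormGaussian {n : ℕ} {g : Finset (Fin n) → ℝ}
    (hg : IsVGaussian n g) : ∃ c : ℝ, 0 < c ∧ ∃ g', IsNormGaussian n g' ∧ g = c • g' := by
  obtain ⟨k, -, A, hA, h⟩ := hg
  let T := 1 + ∑ i, k i
  have hT : 0 < T := by positivity
  have hkT : ∀ i, k i ≤ T := fun i =>
    (Finset.single_le_sum (fun _ _ => Nat.zero_le _) (Finset.mem_univ i)).trans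
      (Nat.le_add_left _ _)
  let j : ((i : Fin n) × Fin (k i)) → Fin n × Fin T := fun x => (x.1, Fin.castLE (hkT x.1) x.2)
  have hj : Function.Injective j := by
    rintro ⟨i, a⟩ ⟨i', a'⟩ hij
    obtain ⟨rfl, ha⟩ := Prod.mk.inj hij
    exact congrArg _ (Fin.castLE_injective _ ha)
  obtain ⟨K, hK, hdet⟩ := exists_posDef_padding
    (c := 2 * Real.pi * Real.exp 1) (by positivity) j hj Prod.fst hA
  refine ⟨T, by positivity, _, ⟨T, hT, K, hK, fun _ => rfl⟩, ?_⟩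
  ext α
  have hcard : Fintype.card {p : Fin n × Fin T // p.1 ∈ α} = T * α.card := by
    have : (Finset.univ.filter fun p : Fin n × Fin T => p.1 ∈ α) = α ×ˢ Finset.univ := by
      ext; simp
    rw [Fintype.card_subtype, this, Finset.card_product, Finset.card_fin, mul_comm]
  have hcard' : Fintype.card {x // (j x).1 ∈ α} = ∑ i ∈ α, k i := by
    have : (Finset.univ.filter fun x => (j x).1 ∈ α) = α.sigma fun _ => Finset.univ := by
      ext; simp [j]
    rw [Fintype.card_subtype, this, Finset.card_sigma]
    simp
  have hα := hdet α
  rw [hcard, hcard'] at hα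
  rw [h α, Pi.smul_apply, smul_eq_mul, hα, ← mul_assoc, mul_one_div_cancel (by positivity),
    one_mul]
  rfl

/-- `con(Υ*_{N,n}) = con(Υ_{v,n})`: the closed convex cone generated by
the normalised Gaussian entropy functions equals the closed convex cone generated by
the v-Gaussian functions. -/
theorem stmt19 (n : ℕ) :
    ccc {g : Finset (Fin n) → ℝ | IsNormGaussian n g} =
      ccc {g : Finset (Fin n) → ℝ | IsVGaussian n g} := by
  apply subset_antisymm
  · exact subset_ccc_of_smul fun _ hg => hg.exists_smul_isVGaussian
  · exact subset_ccc_of_smul fun _ hg => hg.exists_smul_isNormGaussian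

end
end
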